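/- arXiv:2205.04805 — 2 statements merged into one kernel-verified Lean document; each statement's English description precedes it below -/
import Mathlib

section
/- Let (A,B) be a PVCSP template of finite signature σ (i.e., there exists a fractional homomorphism from A to B). Then BLP decides PVCSP(A,B) — i.e., Opt(I,B) ≤ Opt^BLP(I,A) for every non-negative finite-valued σ-structure I — if and only if (A,B) has a symmetric fractional polymorphism of every arity n ≥ 1. -/
open scoped BigOperators Classical

namespace PVCSP

/-! ## Valued structures -/

/-- The value `Val(I,A,h)` of an assignment `h : I → A`, where the input structure is
given by weights `vI` and the template structure by costs `vA` (in `ℚ ∪ {∞}`). -/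
def Val {σ : Type} [Fintype σ] (ar : σ → ℕ) {I A : Type} [Fintype I]
    (vI : ∀ R : σ, (Fin (ar R) → I) → ℚ)
    (vA : ∀ R : σ, (Fin (ar R) → A) → WithTop ℚ) (h : I → A) : WithTop ℚ :=
  ∑ R : σ, ∑ v : Fin (ar R) → I, (vI R v : WithTop ℚ) * vA R (fun i => h (v i))

/-- `Opt(I,A)`: the minimum value over all assignments. -/
def Opt {σ : Type} [Fintype σ] (ar : σ → ℕ) {I A : Type} [Fintype I] [DecidableEq I]
    [Fintype A]
    (vI : ∀ R : σ, (Fin (ar R) → I) → ℚ)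
    (vA : ∀ R : σ, (Fin (ar R) → A) → WithTop ℚ) : WithTop ℚ :=
  (Finset.univ : Finset (I → A)).inf fun h => Val ar vI vA h

/-- Non-negativity of an input (finite-valued) structure. -/
def NNeg {σ : Type} (ar : σ → ℕ) {I : Type}
    (vI : ∀ R : σ, (Fin (ar R) → I) → ℚ) : Prop :=
  ∀ R v, 0 ≤ vI R v

/-- A fractional homomorphism from `A` to `B`. -/
def IsFracHom {σ : Type} [Fintype σ] (ar : σ → ℕ) {A B : Type}
    [Fintype A] [DecidableEq A] [Fintype B]
    (vA : ∀ R : σ, (Fin (ar R) → A) → WithTop ℚ)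
    (vB : ∀ R : σ, (Fin (ar R) → B) → WithTop ℚ)
    (μ : (A → B) → ℚ) : Prop :=
  (∀ f, 0 ≤ μ f) ∧ (∑ f : A → B, μ f = 1) ∧
    ∀ (R : σ) (a : Fin (ar R) → A),
      ∑ f : A → B, (μ f : WithTop ℚ) * vB R (fun i => f (a i)) ≤ vA R a

/-- A symmetric `n`-ary operation. -/
def IsSymmetricOp {A B : Type} {n : ℕ} (f : (Fin n → A) → B) : Prop :=
  ∀ (ρ : Equiv.Perm (Fin n)) (x : Fin n → A), f (fun i => x (ρ i)) = f x

/-- An `n`-ary fractional polymorphism of the pair `(A,B)`. -/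
def IsFracPoly {σ : Type} [Fintype σ] (ar : σ → ℕ) {A B : Type}
    [Fintype A] [DecidableEq A] [Fintype B]
    (vA : ∀ R : σ, (Fin (ar R) → A) → WithTop ℚ)
    (vB : ∀ R : σ, (Fin (ar R) → B) → WithTop ℚ)
    (n : ℕ) (ω : ((Fin n → A) → B) → ℚ) : Prop :=
  (∀ f, 0 ≤ ω f) ∧ (∑ f : (Fin n → A) → B, ω f = 1) ∧
    ∀ (R : σ) (a : Fin n → (Fin (ar R) → A)),
      ∑ f : (Fin n → A) → B, (ω f : WithTop ℚ) * vB R (fun j => f (fun i => a i j))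
        ≤ ((((n : ℚ)⁻¹ : ℚ)) : WithTop ℚ) * ∑ i : Fin n, vA R (a i)

/-- A dual fractional homomorphism from `I` to `J` (both non-negative finite-valued). -/
def IsDualFracHom {σ : Type} [Fintype σ] (ar : σ → ℕ) {I J : Type}
    [Fintype I] [DecidableEq I] [Fintype J] [DecidableEq J]
    (vI : ∀ R : σ, (Fin (ar R) → I) → ℚ)
    (vJ : ∀ R : σ, (Fin (ar R) → J) → ℚ)
    (η : (I → J) → ℚ) : Prop :=
  (∀ f, 0 ≤ η f) ∧ (∑ f : I → J, η f = 1) ∧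
    ∀ (R : σ) (u : Fin (ar R) → J),
      ∑ f : I → J, η f *
          ∑ v ∈ Finset.univ.filter (fun v : Fin (ar R) → I => (fun i => f (v i)) = u), vI R v
        ≤ vJ R u

/-! ## Linear programming relaxations -/

/-- Canonical embedding of `ℚ ∪ {∞}` into the extended reals. -/
noncomputable def toE (x : WithTop ℚ) : EReal :=
  x.recTopCoe ⊤ (fun q => ((q : ℝ) : EReal))

/-- The objective value of an LP solution `pc`. -/
def objVal {σ : Type} [Fintype σ] (ar : σ → ℕ) {I A : Type} [Fintype I] [Fintype A]
    (vI : ∀ R : σ, (Fin (ar R) → I) → ℚ)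
    (vA : ∀ R : σ, (Fin (ar R) → A) → WithTop ℚ)
    (pc : ∀ R : σ, (Fin (ar R) → I) → (Fin (ar R) → A) → ℚ) : WithTop ℚ :=
  ∑ R : σ, ∑ v : Fin (ar R) → I, ∑ a : Fin (ar R) → A,
    (pc R v a : WithTop ℚ) * ((vI R v : WithTop ℚ) * vA R a)

/-- Feasibility for the basic linear programming relaxation `BLP(I,A)`. -/
def BLPFeas {σ : Type} [Fintype σ] (ar : σ → ℕ) {I A : Type} [Fintype I] [Fintype A]
    [DecidableEq A]
    (vI : ∀ R : σ, (Fin (ar R) → I) → ℚ)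
    (vA : ∀ R : σ, (Fin (ar R) → A) → WithTop ℚ)
    (pv : I → A → ℚ)
    (pc : ∀ R : σ, (Fin (ar R) → I) → (Fin (ar R) → A) → ℚ) : Prop :=
  (∀ R v a, 0 < vI R v → 0 ≤ pc R v a) ∧
  (∀ u : I, ∑ a : A, pv u a = 1) ∧
  (∀ R v, 0 < vI R v → ∀ (i : Fin (ar R)) (a : A),
      pv (v i) a = ∑ t ∈ Finset.univ.filter (fun t : Fin (ar R) → A => t i = a), pc R v t) ∧
  (∀ R v, 0 < vI R v → ∀ t : Fin (ar R) → A, vA R t = ⊤ → pc R v t = 0)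

/-- Feasibility for the Sherali–Adams relaxation `SA¹(I,A)`. -/
def SA1Feas {σ : Type} [Fintype σ] (ar : σ → ℕ) {I A : Type} [Fintype I] [Fintype A]
    [DecidableEq A]
    (vI : ∀ R : σ, (Fin (ar R) → I) → ℚ)
    (vA : ∀ R : σ, (Fin (ar R) → A) → WithTop ℚ)
    (pv : I → A → ℚ)
    (pc : ∀ R : σ, (Fin (ar R) → I) → (Fin (ar R) → A) → ℚ) : Prop :=
  BLPFeas ar vI vA pv pc ∧
  (∀ R v, 0 < vI R v → ∀ t : Fin (ar R) → A,
      (∃ i j, v i = v j ∧ t i ≠ t j) → pc R v t = 0)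

/-- The optimal value `Opt^BLP(I,A)` (equal to `⊤` if the program is infeasible). -/
noncomputable def OptBLP {σ : Type} [Fintype σ] (ar : σ → ℕ) {I A : Type}
    [Fintype I] [Fintype A] [DecidableEq A]
    (vI : ∀ R : σ, (Fin (ar R) → I) → ℚ)
    (vA : ∀ R : σ, (Fin (ar R) → A) → WithTop ℚ) : EReal :=
  sInf { x : EReal | ∃ pv pc, BLPFeas ar vI vA pv pc ∧ x = toE (objVal ar vI vA pc) }

/-- The optimal value `Opt^{SA¹}(I,A)` (equal to `⊤` if the program is infeasible). -/
noncomputable def OptSA1 {σ : Type} [Fintype σ] (ar : σ → ℕ) {I A : Type}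
    [Fintype I] [Fintype A] [DecidableEq A]
    (vI : ∀ R : σ, (Fin (ar R) → I) → ℚ)
    (vA : ∀ R : σ, (Fin (ar R) → A) → WithTop ℚ) : EReal :=
  sInf { x : EReal | ∃ pv pc, SA1Feas ar vI vA pv pc ∧ x = toE (objVal ar vI vA pc) }

/-- The structure `LP^m(A)` on the universe of `m`-element multisets over `A`. -/
def lpPow {σ : Type} [Fintype σ] (ar : σ → ℕ) {A : Type} [Fintype A] [DecidableEq A]
    (m : ℕ) (vA : ∀ R : σ, (Fin (ar R) → A) → WithTop ℚ) :
    ∀ R : σ, (Fin (ar R) → Sym A m) → WithTop ℚ :=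
  fun R s =>
    ((((m : ℚ)⁻¹ : ℚ)) : WithTop ℚ) *
      ((Finset.univ.filter (fun t : Fin (ar R) → (Fin m → A) =>
          ∀ j, Multiset.map (t j) Finset.univ.val = Sym.toMultiset (s j))).inf
        (fun t => ∑ i : Fin m, vA R (fun j => t j i)))

/-! ## The graph of an input structure and iterated degrees -/

/-- Potential constraint vertices of the graph `G(I)`. -/
abbrev CVert (σ : Type) (ar : σ → ℕ) (I : Type) := Σ R : σ, (Fin (ar R) → I)

/-- The label of the edge between variable `u` and constraint `c`: the set of
coordinates of `c` at which `u` occurs. -/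
def edgeLab {σ : Type} {ar : σ → ℕ} {I : Type} [DecidableEq I]
    (u : I) (c : CVert σ ar I) : Finset ℕ :=
  (Finset.univ.filter (fun i : Fin (ar c.1) => c.2 i = u)).image Fin.val

/-- The type of `k`-th iterated degrees over signature `σ`. -/
def Deg (σ : Type) : ℕ → Type
  | 0 => Option (σ × ℚ)
  | k+1 => Multiset (Finset ℕ × Deg σ k)

/-- The `k`-th iterated degree of a vertex of `G(I)` (a variable or a constraint). -/
def degV {σ : Type} [Fintype σ] (ar : σ → ℕ) {I : Type} [Fintype I] [DecidableEq I]
    (vI : ∀ R : σ, (Fin (ar R) → I) → ℚ) :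
    (k : ℕ) → (I ⊕ CVert σ ar I) → Deg σ k
  | 0, Sum.inl _ => (none : Option (σ × ℚ))
  | 0, Sum.inr c => some (c.1, vI c.1 c.2)
  | k+1, Sum.inl u =>
      ((Finset.univ.filter
          (fun c : CVert σ ar I => 0 < vI c.1 c.2 ∧ ∃ i, c.2 i = u)).val).map
        (fun c => (edgeLab u c, degV ar vI k (Sum.inr c)))
  | k+1, Sum.inr c =>
      ((Finset.univ.filter (fun u : I => ∃ i, c.2 i = u)).val).map
        (fun u => (edgeLab u c, degV ar vI k (Sum.inl u)))

/-- The full iterated degree type. -/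
def IterDeg (σ : Type) : Type := ∀ k : ℕ, Deg σ k

/-- The iterated degree `δ(x)` of a vertex. -/
def itdeg {σ : Type} [Fintype σ] (ar : σ → ℕ) {I : Type} [Fintype I] [DecidableEq I]
    (vI : ∀ R : σ, (Fin (ar R) → I) → ℚ) (x : I ⊕ CVert σ ar I) : IterDeg σ :=
  fun k => degV ar vI k x

/-- The iterated degree sequence `δ(I)` (a multiset over all vertices of `G(I)`). -/
def degSeq {σ : Type} [Fintype σ] (ar : σ → ℕ) {I : Type} [Fintype I] [DecidableEq I]
    (vI : ∀ R : σ, (Fin (ar R) → I) → ℚ) : Multiset (IterDeg σ) :=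
  (Finset.univ.val.map (fun u : I => itdeg ar vI (Sum.inl u))) +
  ((Finset.univ.filter (fun c : CVert σ ar I => 0 < vI c.1 c.2)).val.map
      (fun c => itdeg ar vI (Sum.inr c)))

/-- Adjacency in the graph `G(I)`. -/
def Adj {σ : Type} (ar : σ → ℕ) {I : Type}
    (vI : ∀ R : σ, (Fin (ar R) → I) → ℚ) :
    (I ⊕ CVert σ ar I) → (I ⊕ CVert σ ar I) → Prop
  | Sum.inl u, Sum.inr c => 0 < vI c.1 c.2 ∧ ∃ i, c.2 i = u
  | Sum.inr c, Sum.inl u => 0 < vI c.1 c.2 ∧ ∃ i, c.2 i = u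
  | _, _ => False

/-- Actual vertices of `G(I)`: all variables and the positive-weight constraints. -/
def IsVert {σ : Type} (ar : σ → ℕ) {I : Type}
    (vI : ∀ R : σ, (Fin (ar R) → I) → ℚ) : (I ⊕ CVert σ ar I) → Prop
  | Sum.inl _ => True
  | Sum.inr c => 0 < vI c.1 c.2

/-- Connectedness of the input structure `I` (i.e. of its graph `G(I)`). -/
def Conn {σ : Type} (ar : σ → ℕ) {I : Type}
    (vI : ∀ R : σ, (Fin (ar R) → I) → ℚ) : Prop :=
  Nonempty I ∧ ∀ x y, IsVert ar vI x → IsVert ar vI y →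
    Relation.ReflTransGen (Adj ar vI) x y

/-- Weak congruence: `|J| ⬝ δ(I) = |I| ⬝ δ(J)`. -/
def WeakCongr {σ : Type} [Fintype σ] (ar : σ → ℕ) {I J : Type}
    [Fintype I] [DecidableEq I] [Fintype J] [DecidableEq J]
    (vI : ∀ R : σ, (Fin (ar R) → I) → ℚ)
    (vJ : ∀ R : σ, (Fin (ar R) → J) → ℚ) : Prop :=
  (Fintype.card J) • degSeq ar vI = (Fintype.card I) • degSeq ar vJ

/-- Membership of a variable in the connected component of the variable `x₀`. -/
def InComp {σ : Type} (ar : σ → ℕ) {I : Type}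
    (vI : ∀ R : σ, (Fin (ar R) → I) → ℚ) (x₀ u : I) : Prop :=
  Relation.ReflTransGen (Adj ar vI) (Sum.inl x₀) (Sum.inl u)
/-! ## Theorems of the alternative over an ordered field -/

/-- **Farkas' lemma** for finitely many linear functionals over a linearly ordered field. -/
theorem exists_nonneg_combination_of_forall_le {K V ι : Type*} [Field K] [LinearOrder K]
    [IsStrictOrderedRing K] [AddCommGroup V] [Module K V] (s : Finset ι) :
    ∀ (A : ι → V →ₗ[K] K) (b : V →ₗ[K] K),
      (∀ x, (∀ j ∈ s, A j x ≤ 0) → b x ≤ 0) →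
      ∃ l : ι → K, (∀ j, 0 ≤ l j) ∧ b = ∑ j ∈ s, l j • A j := by
  induction s using Finset.induction_on with
  | empty =>
    intro A b h
    refine ⟨0, fun _ => le_rfl, ?_⟩
    ext x
    have h1 := h x (by simp)
    have h2 := h (-x) (by simp)
    rw [map_neg] at h2
    simpa using le_antisymm h1 (by linarith)
  | insert a s ha ih =>
    intro A b h
    by_cases hb : ∀ x, (∀ j ∈ s, A j x ≤ 0) → b x ≤ 0
    · obtain ⟨l, hl, hsum⟩ := ih A b hb
      refine ⟨Function.update l a 0, fun j => ?_, ?_⟩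
      · by_cases hj : j = a
        · simp [hj]
        · simpa [hj] using hl j
      · rw [Finset.sum_insert ha, Function.update_self, zero_smul, zero_add, hsum]
        refine Finset.sum_congr rfl fun j hj => ?_
        rw [Function.update_of_ne (ne_of_mem_of_not_mem hj ha)]
    · push Not at hb
      obtain ⟨x₀, hx₀, hbx₀⟩ := hb
      have hpos : 0 < A a x₀ := by
        by_contra hle
        refine absurd (h x₀ fun j hj => ?_) (not_le.mpr hbx₀)
        rcases Finset.mem_insert.mp hj with rfl | hj
        · exact not_lt.mp hle
        · exact hx₀ j hj
      obtain ⟨l, hl, hsum⟩ := ih (fun j => A j - (A j x₀ / A a x₀) • A a)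
        (b - (b x₀ / A a x₀) • A a) (by
          intro x hx
          have key := h (x - (A a x / A a x₀) • x₀) (by
            intro j hj
            rcases Finset.mem_insert.mp hj with rfl | hj
            · simp [hpos.ne']
            · have := hx j hj
              simp only [LinearMap.sub_apply, LinearMap.smul_apply, smul_eq_mul] at this
              simp only [map_sub, map_smul, smul_eq_mul]
              convert this using 2
              ring)
          simp only [map_sub, map_smul, smul_eq_mul] at key
          simp only [LinearMap.sub_apply, LinearMap.smul_apply, smul_eq_mul]
          convert key using 2
          ring)
      set r : K := b x₀ / A a x₀ - ∑ j ∈ s, l j * (A j x₀ / A a x₀) with hr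
      have hr0 : 0 ≤ r := by
        have h1 : 0 ≤ b x₀ / A a x₀ := (div_pos hbx₀ hpos).le
        have h2 : ∑ j ∈ s, l j * (A j x₀ / A a x₀) ≤ 0 :=
          Finset.sum_nonpos fun j hj =>
            mul_nonpos_of_nonneg_of_nonpos (hl j) (div_nonpos_of_nonpos_of_nonneg (hx₀ j hj) hpos.le)
        linarith
      refine ⟨Function.update l a r, fun j => ?_, ?_⟩
      · by_cases hj : j = a
        · simpa [hj] using hr0
        · simpa [hj] using hl j
      · rw [Finset.sum_insert ha, Function.update_self]
        have : ∑ j ∈ s, Function.update l a r j • A j = ∑ j ∈ s, l j • A j :=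
          Finset.sum_congr rfl fun j hj => by
            rw [Function.update_of_ne (ne_of_mem_of_not_mem hj ha)]
        rw [this]
        have hb : b = (b x₀ / A a x₀) • A a +
            ∑ j ∈ s, l j • (A j - (A j x₀ / A a x₀) • A a) := by
          rw [← hsum]; abel
        ext x
        have hbx := congrArg (fun φ => φ x) hb
        simp only [LinearMap.add_apply, LinearMap.sum_apply, LinearMap.smul_apply,
          LinearMap.sub_apply, smul_eq_mul, mul_sub, Finset.sum_sub_distrib] at hbx
        simp only [LinearMap.add_apply, LinearMap.sum_apply, LinearMap.smul_apply, smul_eq_mul]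
        rw [hbx, hr, sub_mul, Finset.sum_mul]
        have : ∑ j ∈ s, l j * (A j x₀ / A a x₀ * A a x)
            = ∑ j ∈ s, l j * (A j x₀ / A a x₀) * A a x :=
          Finset.sum_congr rfl fun j _ => by ring
        rw [this]
        ring

/-- **Ville's theorem of the alternative**: for a finite matrix `M` with rows indexed by `s`, either
some non-negative weighting of the columns is positive on every row, or some probability
distribution on the rows makes every column average non-positive. -/
theorem exists_pos_weighting_or_distribution {K F C : Type*} [Field K] [LinearOrder K]
    [IsStrictOrderedRing K] [Fintype C] (s : Finset F) (M : F → C → K) :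
    (∃ y : C → K, (∀ c, 0 ≤ y c) ∧ ∀ f ∈ s, 0 < ∑ c, y c * M f c) ∨
      ∃ w : F → K, (∀ f, 0 ≤ w f) ∧ ∑ f ∈ s, w f = 1 ∧ ∀ c, ∑ f ∈ s, w f * M f c ≤ 0 := by
  by_contra hcon
  push Not at hcon
  obtain ⟨hy, hw⟩ := hcon
  let A : C ⊕ F → ((C → K) × K) →ₗ[K] K := Sum.elim
    (fun c => -(LinearMap.proj c ∘ₗ LinearMap.fst K (C → K) K))
    (fun f => LinearMap.snd K (C → K) K -
      (∑ c, M f c • LinearMap.proj c) ∘ₗ LinearMap.fst K (C → K) K)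
  obtain ⟨l, hl, hsum⟩ := exists_nonneg_combination_of_forall_le (Finset.univ.disjSum s) A
    (LinearMap.snd K (C → K) K) (by
      rintro ⟨y, t⟩ h
      have hy0 : ∀ c, 0 ≤ y c := fun c => by
        simpa [A] using h (Sum.inl c) (by simp)
      obtain ⟨f, hf, hle⟩ := hy y hy0
      have hft : t ≤ ∑ c, M f c * y c := by
        simpa [A, LinearMap.sum_apply] using h (Sum.inr f) (by simpa using hf)
      have : ∑ c, M f c * y c = ∑ c, y c * M f c :=
        Finset.sum_congr rfl fun c _ => mul_comm _ _
      simp only [LinearMap.snd_apply]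
      linarith)
  rw [Finset.sum_disjSum] at hsum
  have hone : ∑ f ∈ s, l (Sum.inr f) = 1 := by
    have := congrArg (fun φ => φ ((0 : C → K), (1 : K))) hsum
    simpa [A, LinearMap.sum_apply] using this.symm
  obtain ⟨c, hc⟩ := hw (fun f => l (Sum.inr f)) (fun f => hl _) hone
  have hcol := congrArg (fun φ => φ (Pi.single c (1 : K), (0 : K))) hsum
  simp [A, LinearMap.sum_apply, Pi.single_apply] at hcol
  have := hl (Sum.inl c)
  linarith

/-! ## Rational distributions as uniform samples -/

theorem exists_perm_of_forall_sum_eq {ι T : Type*} [Fintype ι] (x y : ι → T)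
    (h : ∀ φ : T → ℚ, ∑ i, φ (x i) = ∑ i, φ (y i)) :
    ∃ ρ : Equiv.Perm ι, ∀ i, x (ρ i) = y i := by
  have hcard : ∀ t, Fintype.card {i // y i = t} = Fintype.card {i // x i = t} := by
    intro t
    have := h (fun u => if u = t then 1 else 0)
    simp only [Finset.sum_boole] at this
    rw [Fintype.card_subtype, Fintype.card_subtype]
    exact_mod_cast this.symm
  exact ⟨Equiv.ofFiberEquiv fun t => Fintype.equivOfCardEq (hcard t),
    fun i => Equiv.ofFiberEquiv_map _ i⟩

theorem exists_sample_of_integer_multiples {T : Type*} [Fintype T] (p : T → ℚ)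
    (hp : ∀ t, 0 ≤ p t) (hsum : ∑ t, p t = 1) (n : ℕ) (hint : ∀ t, ∃ z : ℤ, (n : ℚ) * p t = z) :
    ∃ x : Fin n → T, ∀ φ : T → ℚ, ∑ i, φ (x i) = n * ∑ t, p t * φ t := by
  have hnat : ∀ t, ∃ k : ℕ, (k : ℚ) = n * p t := by
    intro t
    obtain ⟨z, hz⟩ := hint t
    have hz0 : 0 ≤ z := by
      have : (0 : ℚ) ≤ z := hz ▸ mul_nonneg (Nat.cast_nonneg n) (hp t)
      exact_mod_cast this
    lift z to ℕ using hz0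
    exact ⟨z, by rw [hz]; simp⟩
  choose k hk using hnat
  have hcard : Fintype.card (Σ t, Fin (k t)) = n := by
    have : ((∑ t, k t : ℕ) : ℚ) = n := by
      push_cast
      simp only [hk, ← Finset.mul_sum, hsum, mul_one]
    simpa using (by exact_mod_cast this : ∑ t, k t = n)
  let e : Fin n ≃ Σ t, Fin (k t) := (Fintype.equivFinOfCardEq hcard).symm
  refine ⟨fun i => (e i).1, fun φ => ?_⟩
  rw [Equiv.sum_comp e (fun s => φ s.1), Fintype.sum_sigma, Finset.mul_sum]
  refine Finset.sum_congr rfl fun t _ => ?_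
  simp [hk, mul_assoc]

theorem exists_common_denominator {ι : Type*} [Finite ι] (q : ι → ℚ) :
    ∃ n : ℕ, 1 ≤ n ∧ ∀ i, ∃ z : ℤ, (n : ℚ) * q i = z := by
  cases nonempty_fintype ι
  refine ⟨∏ i, (q i).den, Nat.one_le_iff_ne_zero.mpr
    (Finset.prod_ne_zero_iff.mpr fun i _ => (q i).den_ne_zero), fun i => ?_⟩
  obtain ⟨m, hm⟩ := Finset.dvd_prod_of_mem (fun i => (q i).den) (Finset.mem_univ i)
  refine ⟨m * (q i).num, ?_⟩
  rw [hm]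
  push_cast
  rw [mul_comm ((q i).den : ℚ), mul_assoc, Rat.den_mul_eq_num]

/-! ## Weighted sums with values in `ℚ ∪ {∞}` -/

theorem coe_untopD_zero {x : WithTop ℚ} (hx : x ≠ ⊤) : ((x.untopD 0 : ℚ) : WithTop ℚ) = x := by
  lift x to ℚ using hx
  rfl

theorem coe_mul_eq_coe_untopD {w : ℚ} {x : WithTop ℚ} (h : w ≠ 0 → x ≠ ⊤) :
    (w : WithTop ℚ) * x = ((w * x.untopD 0 : ℚ) : WithTop ℚ) := by
  by_cases hw : w = 0
  · simp [hw]
  · rw [WithTop.coe_mul, coe_untopD_zero (h hw)]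

theorem sum_coe_mul_eq_coe_untopD {ι : Type*} (s : Finset ι) (w : ι → ℚ) (x : ι → WithTop ℚ)
    (h : ∀ i ∈ s, w i ≠ 0 → x i ≠ ⊤) :
    ∑ i ∈ s, (w i : WithTop ℚ) * x i = ((∑ i ∈ s, w i * (x i).untopD 0 : ℚ) : WithTop ℚ) := by
  rw [WithTop.coe_sum]
  exact Finset.sum_congr rfl fun i hi => coe_mul_eq_coe_untopD (h i hi)

theorem ne_top_of_sum_coe_mul_ne_top {ι : Type*} {s : Finset ι} {w : ι → ℚ} {x : ι → WithTop ℚ}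
    (h : ∑ i ∈ s, (w i : WithTop ℚ) * x i ≠ ⊤) : ∀ i ∈ s, w i ≠ 0 → x i ≠ ⊤ := by
  intro i hi hw hx
  refine h (WithTop.sum_eq_top.mpr ⟨i, hi, ?_⟩)
  rw [hx, WithTop.mul_top (by exact_mod_cast hw)]

theorem sum_eq_coe_untopD {ι : Type*} {s : Finset ι} {x : ι → WithTop ℚ}
    (h : ∀ i ∈ s, x i ≠ ⊤) :
    ∑ i ∈ s, x i = ((∑ i ∈ s, (x i).untopD 0 : ℚ) : WithTop ℚ) := by
  rw [WithTop.coe_sum]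
  exact Finset.sum_congr rfl fun i hi => (coe_untopD_zero (h i hi)).symm

theorem toE_le_toE {x y : WithTop ℚ} : toE x ≤ toE y ↔ x ≤ y := by
  cases x <;> cases y <;> simp [toE, WithTop.recTopCoe]

theorem Val_eq_coe {σ : Type} [Fintype σ] {ar : σ → ℕ} {I B : Type} [Fintype I]
    {vI : ∀ R : σ, (Fin (ar R) → I) → ℚ} {vB : ∀ R : σ, (Fin (ar R) → B) → WithTop ℚ}
    {h : I → B} (hfin : ∀ R v, vI R v ≠ 0 → vB R (fun i => h (v i)) ≠ ⊤) :
    Val ar vI vB h =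
      ((∑ R, ∑ v, vI R v * (vB R (fun i => h (v i))).untopD 0 : ℚ) : WithTop ℚ) := by
  rw [Val, WithTop.coe_sum]
  exact Finset.sum_congr rfl fun R _ =>
    sum_coe_mul_eq_coe_untopD _ _ _ fun v _ => hfin R v

theorem ne_top_of_Val_ne_top {σ : Type} [Fintype σ] {ar : σ → ℕ} {I B : Type} [Fintype I]
    {vI : ∀ R : σ, (Fin (ar R) → I) → ℚ} {vB : ∀ R : σ, (Fin (ar R) → B) → WithTop ℚ}
    {h : I → B} (hval : Val ar vI vB h ≠ ⊤) (R : σ) (v : Fin (ar R) → I) (hv : vI R v ≠ 0) :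
    vB R (fun i => h (v i)) ≠ ⊤ := by
  refine ne_top_of_sum_coe_mul_ne_top (x := fun v => vB R fun i => h (v i)) (fun htop => ?_) v
    (Finset.mem_univ v) hv
  exact hval (WithTop.sum_eq_top.mpr ⟨R, Finset.mem_univ R, htop⟩)

theorem objVal_eq_coe {σ : Type} [Fintype σ] {ar : σ → ℕ} {I A : Type} [Fintype I] [Fintype A]
    {vI : ∀ R : σ, (Fin (ar R) → I) → ℚ} {vA : ∀ R : σ, (Fin (ar R) → A) → WithTop ℚ}
    {pc : ∀ R : σ, (Fin (ar R) → I) → (Fin (ar R) → A) → ℚ}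
    (hfin : ∀ R v t, vI R v ≠ 0 → pc R v t ≠ 0 → vA R t ≠ ⊤) :
    objVal ar vI vA pc =
      ((∑ R, ∑ v, vI R v * ∑ t, pc R v t * (vA R t).untopD 0 : ℚ) : WithTop ℚ) := by
  simp only [objVal, WithTop.coe_sum, Finset.mul_sum]
  refine Finset.sum_congr rfl fun R _ => Finset.sum_congr rfl fun v _ =>
    Finset.sum_congr rfl fun t _ => ?_
  rw [← mul_assoc, ← WithTop.coe_mul, coe_mul_eq_coe_untopD]
  · congr 1
    ring
  · intro hne
    exact hfin R v t (right_ne_zero_of_mul hne) (left_ne_zero_of_mul hne)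

/-! ## From symmetric fractional polymorphisms to rounding of LP solutions -/

theorem Opt_le_objVal_of_symmetric_fracPoly {σ : Type} [Fintype σ] {ar : σ → ℕ}
    (har : ∀ R, 0 < ar R) {A B : Type} [Fintype A] [DecidableEq A] [Fintype B]
    {vA : ∀ R : σ, (Fin (ar R) → A) → WithTop ℚ} {vB : ∀ R : σ, (Fin (ar R) → B) → WithTop ℚ}
    (hsym : ∀ n : ℕ, 1 ≤ n → ∃ ω : ((Fin n → A) → B) → ℚ,
      IsFracPoly ar vA vB n ω ∧ ∀ f, 0 < ω f → IsSymmetricOp f)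
    {I : Type} [Fintype I] [DecidableEq I] {vI : ∀ R : σ, (Fin (ar R) → I) → ℚ}
    (hI : NNeg ar vI) {pv : I → A → ℚ}
    {pc : ∀ R : σ, (Fin (ar R) → I) → (Fin (ar R) → A) → ℚ} (hfeas : BLPFeas ar vI vA pv pc) :
    Opt ar vI vB ≤ objVal ar vI vA pc := by
  obtain ⟨hpc0, hpv, hmarg, htop⟩ := hfeas
  have hpos : ∀ {R v}, vI R v ≠ 0 → 0 < vI R v := fun h => lt_of_le_of_ne (hI _ _) h.symm
  have hcol : ∀ R v, 0 < vI R v → ∀ (j : Fin (ar R)) (φ : A → ℚ),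
      ∑ t, pc R v t * φ (t j) = ∑ b, pv (v j) b * φ b := by
    intro R v h j φ
    rw [← Finset.sum_fiberwise _ (fun t : Fin (ar R) → A => t j)]
    refine Finset.sum_congr rfl fun b _ => ?_
    rw [hmarg R v h j b, Finset.sum_mul]
    refine Finset.sum_congr (by congr) fun t ht => ?_
    rw [(Finset.mem_filter.mp ht).2]
  have hone : ∀ R v, 0 < vI R v → ∑ t, pc R v t = 1 := by
    intro R v h
    have := hcol R v h ⟨0, har R⟩ (fun _ => 1)
    simpa [hpv] using this
  obtain ⟨n, hn, hint⟩ := exists_common_denominator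
    (fun c : Σ R : σ, (Fin (ar R) → I) × (Fin (ar R) → A) => pc c.1 c.2.1 c.2.2)
  have hn0 : (n : ℚ) ≠ 0 := by exact_mod_cast (by omega : n ≠ 0)
  have hsample : ∀ R v, 0 < vI R v → ∃ a : Fin n → Fin (ar R) → A, ∀ φ : (Fin (ar R) → A) → ℚ,
      ∑ i, φ (a i) = n * ∑ t, pc R v t * φ t := fun R v h =>
    exists_sample_of_integer_multiples (pc R v) (fun t => hpc0 R v t h) (hone R v h) n
      (fun t => hint ⟨R, v, t⟩)
  choose a ha using hsample
  have hx : ∀ u, ∃ x : Fin n → A, ∀ R v (h : 0 < vI R v) j, v j = u → ∀ φ : A → ℚ,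
      ∑ i, φ (a R v h i j) = ∑ i, φ (x i) := by
    intro u
    by_cases hu : ∃ R v, 0 < vI R v ∧ ∃ j, v j = u
    · obtain ⟨R₀, v₀, h₀, j₀, rfl⟩ := hu
      refine ⟨fun i => a R₀ v₀ h₀ i j₀, fun R v h j hj φ => ?_⟩
      rw [ha R v h (fun t => φ (t j)), ha R₀ v₀ h₀ (fun t => φ (t j₀)), hcol R v h,
        hcol R₀ v₀ h₀, hj]
    · have hA : Nonempty A := by
        by_contra hA
        rw [not_nonempty_iff] at hA
        simpa using hpv u
      exact ⟨fun _ => hA.some, fun R v h j hj => (hu ⟨R, v, h, j, hj⟩).elim⟩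
  choose x hx using hx
  obtain ⟨ω, ⟨hω0, hω1, hω⟩, hωsym⟩ := hsym n hn
  have hcols : ∀ f, ω f ≠ 0 → ∀ R v (h : 0 < vI R v) j,
      f (fun i => a R v h i j) = f (x (v j)) := by
    intro f hf R v h j
    obtain ⟨ρ, hρ⟩ := exists_perm_of_forall_sum_eq _ _ (hx (v j) R v h j rfl)
    rw [← hωsym f (lt_of_le_of_ne (hω0 f) hf.symm) ρ]
    exact congrArg f (funext hρ)
  have hround : ∀ R v, 0 < vI R v →
      ∑ f, (ω f : WithTop ℚ) * vB R (fun j => f (x (v j)))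
        ≤ ((∑ t, pc R v t * (vA R t).untopD 0 : ℚ) : WithTop ℚ) := by
    intro R v h
    have hfin : ∀ i ∈ Finset.univ, vA R (a R v h i) ≠ ⊤ := by
      intro i _ hi
      have hsum := ha R v h (fun t => if t = a R v h i then 1 else 0)
      simp only [mul_ite, mul_one, mul_zero, Finset.sum_ite_eq', Finset.mem_univ, if_true,
        htop R v h _ hi] at hsum
      have := (Finset.sum_eq_zero_iff_of_nonneg (fun k _ => by positivity)).mp hsum i
        (Finset.mem_univ i)
      simp at this
    calc ∑ f, (ω f : WithTop ℚ) * vB R (fun j => f (x (v j)))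
        = ∑ f, (ω f : WithTop ℚ) * vB R (fun j => f (fun i => a R v h i j)) := by
          refine Finset.sum_congr rfl fun f _ => ?_
          by_cases hf : ω f = 0
          · simp [hf]
          · simp only [hcols f hf R v h]
      _ ≤ _ := hω R (a R v h)
      _ = _ := by
          rw [sum_eq_coe_untopD hfin, ← WithTop.coe_mul,
            ha R v h (fun t => (vA R t).untopD 0), inv_mul_cancel_left₀ hn0]
  have hfinB : ∀ f, ω f ≠ 0 → ∀ R v, vI R v ≠ 0 → vB R (fun j => f (x (v j))) ≠ ⊤ := by
    intro f hf R v h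
    exact ne_top_of_sum_coe_mul_ne_top
      (ne_top_of_le_ne_top WithTop.coe_ne_top (hround R v (hpos h))) f (Finset.mem_univ f) hf
  have havg : ∀ R v, vI R v * ∑ f, ω f * (vB R (fun j => f (x (v j)))).untopD 0
      ≤ vI R v * ∑ t, pc R v t * (vA R t).untopD 0 := by
    intro R v
    by_cases h : vI R v = 0
    · simp [h]
    · refine mul_le_mul_of_nonneg_left ?_ (hI R v)
      have := hround R v (hpos h)
      rw [sum_coe_mul_eq_coe_untopD _ _ _ (fun f _ hf => hfinB f hf R v h)] at this
      exact_mod_cast this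
  rw [objVal_eq_coe fun R v t hv ht h => ht (htop R v (hpos hv) t h)]
  set obj : ℚ := ∑ R, ∑ v, vI R v * ∑ t, pc R v t * (vA R t).untopD 0 with hobj
  let cost : ((Fin n → A) → B) → ℚ := fun f =>
    ∑ R, ∑ v, vI R v * (vB R (fun j => f (x (v j)))).untopD 0
  have htotal : ∑ f, ω f * cost f ≤ ∑ f, ω f * obj := by
    rw [← Finset.sum_mul, hω1, one_mul, hobj]
    refine le_trans (le_of_eq ?_) (Finset.sum_le_sum fun R _ => Finset.sum_le_sum fun v _ =>
      havg R v)
    simp only [cost, Finset.mul_sum]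
    rw [Finset.sum_comm]
    refine Finset.sum_congr rfl fun R _ => ?_
    rw [Finset.sum_comm]
    exact Finset.sum_congr rfl fun v _ => Finset.sum_congr rfl fun f _ => by ring
  obtain ⟨f, hf, hle⟩ : ∃ f, ω f ≠ 0 ∧ cost f ≤ obj := by
    by_contra hcon
    push Not at hcon
    obtain ⟨f, hf⟩ : ∃ f, ω f ≠ 0 := by
      by_contra hzero
      push Not at hzero
      simp [hzero] at hω1
    refine absurd htotal (not_le.mpr (Finset.sum_lt_sum (fun g _ => ?_)
      ⟨f, Finset.mem_univ f, mul_lt_mul_of_pos_left (hcon f hf)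
        (lt_of_le_of_ne (hω0 f) hf.symm)⟩))
    by_cases hg : ω g = 0
    · simp [hg]
    · exact mul_le_mul_of_nonneg_left (hcon g hg).le (hω0 g)
  refine (Finset.inf_le (Finset.mem_univ fun u => f (x u))).trans ?_
  rw [Val_eq_coe (hfinB f hf)]
  exact_mod_cast hle

/-! ## From the LP bound to symmetric fractional polymorphisms -/

theorem exists_perm_invariant_representative (ι T : Type*) [Fintype ι] :
    ∃ q : (ι → T) → ι → T, (∀ x, ∃ ρ : Equiv.Perm ι, ∀ i, x (ρ i) = q x i) ∧
      ∀ (ρ : Equiv.Perm ι) (x : ι → T), q (fun i => x (ρ i)) = q x := by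
  by_cases hne : Nonempty (ι → T)
  · let m : (ι → T) → (T → ℚ) → ℚ := fun x φ => ∑ i, φ (x i)
    refine ⟨fun x => Function.invFun m (m x), fun x => ?_, fun ρ x => ?_⟩
    · have : m (Function.invFun m (m x)) = m x := Function.invFun_eq ⟨x, rfl⟩
      exact exists_perm_of_forall_sum_eq _ _ fun φ => (congrFun this φ).symm
    · have : m (fun i => x (ρ i)) = m x := funext fun φ => Equiv.sum_comp ρ (fun i => φ (x i))
      simp only [this]
  · exact ⟨id, fun x => (hne ⟨x⟩).elim, fun _ x => (hne ⟨x⟩).elim⟩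

theorem exists_nonneg_scaling_pos {F : Type*} (s : Finset F) (p d : F → ℚ)
    (hp : ∀ f ∈ s, 0 < p f) : ∃ K : ℚ, 0 ≤ K ∧ ∀ f ∈ s, 0 < K * p f + d f := by
  obtain ⟨K, hK⟩ := Finset.exists_le (insert 0 (s.image fun f => (1 - d f) / p f))
  refine ⟨K, hK 0 (Finset.mem_insert_self _ _), fun f hf => ?_⟩
  have := hK _ (Finset.mem_insert_of_mem (Finset.mem_image_of_mem _ hf))
  rw [div_le_iff₀ (hp f hf)] at this
  linarith

theorem sum_uniform_mul {ι T : Type*} [Fintype ι] [Fintype T] [DecidableEq T] (c : ℚ) (x : ι → T) (φ : T → ℚ) :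
    ∑ t, (c * ∑ i, if x i = t then 1 else 0) * φ t = c * ∑ i, φ (x i) := by
  simp only [mul_assoc, ← Finset.mul_sum, Finset.sum_mul]
  rw [Finset.sum_comm]
  simp

theorem exists_symmetric_fracPoly_of_Opt_le_objVal {σ : Type} [Fintype σ] {ar : σ → ℕ}
    {A B : Type} [Fintype A] [DecidableEq A] [Fintype B]
    {vA : ∀ R : σ, (Fin (ar R) → A) → WithTop ℚ} {vB : ∀ R : σ, (Fin (ar R) → B) → WithTop ℚ}
    {n : ℕ} (hn : 1 ≤ n)
    (hle : ∀ (vI : ∀ R : σ, (Fin (ar R) → Fin n → A) → ℚ), NNeg ar vI →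
      ∀ pv pc, BLPFeas ar vI vA pv pc → Opt ar vI vB ≤ objVal ar vI vA pc) :
    ∃ ω : ((Fin n → A) → B) → ℚ, IsFracPoly ar vA vB n ω ∧ ∀ f, 0 < ω f → IsSymmetricOp f := by
  have hn0 : (n : ℚ) ≠ 0 := by exact_mod_cast (by omega : n ≠ 0)
  obtain ⟨q, hqperm, hqinv⟩ := exists_perm_invariant_representative (Fin n) A
  have hqq : ∀ x, q (q x) = q x := fun x => by
    obtain ⟨ρ, hρ⟩ := hqperm x
    rw [← hqinv ρ x]
    exact congrArg q (funext fun i => by rw [hqinv, ← hρ])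
  have hqsym : ∀ f : (Fin n → A) → B, IsSymmetricOp f → ∀ x, f (q x) = f x := fun f hf x => by
    obtain ⟨ρ, hρ⟩ := hqperm x
    rw [← hf ρ x]
    exact congrArg f (funext fun i => (hρ i).symm)
  have hmin : ∀ R (s : Fin (ar R) → Fin n → A), ∃ a₀ : Fin n → Fin (ar R) → A,
      ∀ a : Fin n → Fin (ar R) → A, (∀ j, q (fun i => a i j) = s j) →
        (∀ j, q (fun i => a₀ i j) = s j) ∧ ∑ i, vA R (a₀ i) ≤ ∑ i, vA R (a i) := by
    intro R s
    by_cases hex : ∃ a : Fin n → Fin (ar R) → A, ∀ j, q (fun i => a i j) = s j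
    · obtain ⟨a, ha⟩ := hex
      obtain ⟨a₀, ha₀, hmin⟩ := Finset.exists_min_image
        (Finset.univ.filter fun a : Fin n → Fin (ar R) → A => ∀ j, q (fun i => a i j) = s j)
        (fun a => ∑ i, vA R (a i)) ⟨a, by simpa using ha⟩
      exact ⟨a₀, fun b hb => ⟨by simpa using ha₀, hmin b (by simpa using hb)⟩⟩
    · exact ⟨fun i j => s j i, fun a ha => (hex ⟨a, ha⟩).elim⟩
  choose a₀ ha₀ using hmin
  let good : CVert σ ar (Fin n → A) → Prop := fun c =>
    (∀ j, q (fun i => a₀ c.1 c.2 i j) = c.2 j) ∧ ∀ i, vA c.1 (a₀ c.1 c.2 i) ≠ ⊤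
  let bound : CVert σ ar (Fin n → A) → ℚ := fun c =>
    (n : ℚ)⁻¹ * ∑ i, (vA c.1 (a₀ c.1 c.2 i)).untopD 0
  let S : Finset ((Fin n → A) → B) := Finset.univ.filter fun f =>
    IsSymmetricOp f ∧ ∀ c, good c → vB c.1 (fun j => f (c.2 j)) ≠ ⊤
  let M : ((Fin n → A) → B) → CVert σ ar (Fin n → A) → ℚ := fun f c =>
    if good c then (vB c.1 (fun j => f (c.2 j))).untopD 0 - bound c else 0
  rcases exists_pos_weighting_or_distribution S M with ⟨y, hy0, hy⟩ | ⟨w, hw0, hw1, hw⟩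
  · exfalso
    obtain ⟨K, hK0, hK⟩ := exists_nonneg_scaling_pos S (fun f => ∑ c, y c * M f c)
      (fun f => ∑ c, M f c) hy
    let vI : ∀ R : σ, (Fin (ar R) → Fin n → A) → ℚ := fun R s =>
      if good ⟨R, s⟩ then K * y ⟨R, s⟩ + 1 else 0
    have hvI : ∀ R s, good ⟨R, s⟩ → 0 < vI R s := fun R s h => by
      have := mul_nonneg hK0 (hy0 ⟨R, s⟩)
      simp only [vI, if_pos h]
      linarith
    have hgood : ∀ R s, vI R s ≠ 0 → good ⟨R, s⟩ := fun R s h => by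
      by_contra hbad
      exact h (if_neg hbad)
    have hnn : NNeg ar vI := fun R s => by
      by_cases h : good ⟨R, s⟩
      · exact (hvI R s h).le
      · simp [vI, h]
    let pv : (Fin n → A) → A → ℚ := fun x b => (n : ℚ)⁻¹ * ∑ i, if x i = b then 1 else 0
    let pc : ∀ R : σ, (Fin (ar R) → Fin n → A) → (Fin (ar R) → A) → ℚ := fun R s t =>
      (n : ℚ)⁻¹ * ∑ i, if a₀ R s i = t then 1 else 0
    have hpctop : ∀ R s, good ⟨R, s⟩ → ∀ t, vA R t = ⊤ → pc R s t = 0 := by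
      intro R s h t ht
      have : ∀ i, a₀ R s i ≠ t := fun i hi => h.2 i (hi ▸ ht)
      simp [pc, this]
    have hfeas : BLPFeas ar vI vA pv pc := by
      refine ⟨fun R s t _ => ?_, fun x => ?_, fun R s h j b => ?_,
        fun R s h => hpctop R s (hgood R s h.ne')⟩
      · exact mul_nonneg (by positivity) (Finset.sum_nonneg fun i _ => by positivity)
      · have := sum_uniform_mul (n : ℚ)⁻¹ x (fun _ => 1)
        simpa only [pv, mul_one, Finset.sum_const, Finset.card_univ, Fintype.card_fin,
          nsmul_eq_mul, inv_mul_cancel₀ hn0] using this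
      · have hsj := (hgood R s h.ne').1 j
        obtain ⟨ρ, hρ⟩ := hqperm (fun i => a₀ R s i j)
        have hcol := sum_uniform_mul (n : ℚ)⁻¹ (a₀ R s) (fun t => if t j = b then 1 else 0)
        simp only [mul_ite, mul_one, mul_zero] at hcol
        rw [Finset.sum_filter]
        refine Eq.trans ?_ hcol.symm
        simp only [pv]
        rw [← Equiv.sum_comp ρ (fun i => if a₀ R s i j = b then (1 : ℚ) else 0)]
        simp only [hρ, hsj]
    have hopt := hle vI hnn pv pc hfeas
    rw [objVal_eq_coe fun R s t hs ht h => ht (hpctop R s (hgood R s hs) t h), Opt,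
      Finset.inf_le_iff (WithTop.coe_lt_top _)] at hopt
    obtain ⟨h, -, hval⟩ := hopt
    have hfin := ne_top_of_Val_ne_top (ne_top_of_le_ne_top WithTop.coe_ne_top hval)
    rw [Val_eq_coe hfin, WithTop.coe_le_coe] at hval
    have hhq : ∀ R (s : Fin (ar R) → Fin n → A), good ⟨R, s⟩ → ∀ j, h (q (s j)) = h (s j) :=
      fun R s hs j => by
      have hsj : q (fun i => a₀ R s i j) = s j := hs.1 j
      rw [← hsj, hqq]
    have hmem : (fun x => h (q x)) ∈ S := by
      refine Finset.mem_filter.mpr ⟨Finset.mem_univ _, fun ρ x => by simp only [hqinv], ?_⟩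
      rintro ⟨R, s⟩ hs
      simp only [hhq R s hs]
      exact hfin R s (hvI R s hs).ne'
    refine absurd (hK _ hmem) (not_lt.mpr ?_)
    rw [Finset.mul_sum, ← Finset.sum_add_distrib, Fintype.sum_sigma]
    rw [← sub_nonpos, ← Finset.sum_sub_distrib] at hval
    refine le_trans (le_of_eq (Finset.sum_congr rfl fun R _ => ?_)) hval
    rw [← Finset.sum_sub_distrib]
    refine Finset.sum_congr rfl fun s _ => ?_
    by_cases hs : good ⟨R, s⟩
    · simp only [M, vI, if_pos hs, hhq R s hs, pc, bound, sum_uniform_mul]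
      ring
    · simp [M, vI, if_neg hs]
  · refine ⟨fun f => if f ∈ S then w f else 0, ⟨fun f => ?_, ?_, fun R a => ?_⟩, fun f hf => ?_⟩
    · by_cases hf : f ∈ S
      · simpa [hf] using hw0 f
      · simp [hf]
    · simpa using hw1
    · by_cases htop : ∑ i, vA R (a i) = ⊤
      · rw [htop, WithTop.mul_top (by exact_mod_cast inv_ne_zero hn0)]
        exact le_top
      · let s : Fin (ar R) → Fin n → A := fun j => q (fun i => a i j)
        obtain ⟨hcols, hsum⟩ := ha₀ R s a (fun _ => rfl)
        have hfin : ∀ i, vA R (a₀ R s i) ≠ ⊤ := fun i hi =>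
          htop (top_le_iff.mp (le_trans
            (top_le_iff.mpr (WithTop.sum_eq_top.mpr ⟨i, Finset.mem_univ i, hi⟩)) hsum))
        have hs : good ⟨R, s⟩ := ⟨hcols, hfin⟩
        have hfina : ∀ i ∈ Finset.univ, vA R (a i) ≠ ⊤ := fun i hi h =>
          htop (WithTop.sum_eq_top.mpr ⟨i, hi, h⟩)
        have hS : ∀ f ∈ S, vB R (fun j => f (fun i => a i j)) = vB R (fun j => f (s j)) ∧
            vB R (fun j => f (s j)) ≠ ⊤ := fun f hf => by
          obtain ⟨-, hsymf, hff⟩ := Finset.mem_filter.mp hf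
          exact ⟨by simp only [s, hqsym f hsymf], hff ⟨R, s⟩ hs⟩
        rw [sum_coe_mul_eq_coe_untopD _ _ _ fun f _ hf => ?_, sum_eq_coe_untopD hfina,
          ← WithTop.coe_mul, WithTop.coe_le_coe]
        · have hle := hw ⟨R, s⟩
          simp only [M, if_pos hs, mul_sub, Finset.sum_sub_distrib, ← Finset.sum_mul, hw1,
            one_mul, sub_nonpos] at hle
          rw [sum_eq_coe_untopD hfina, sum_eq_coe_untopD fun i _ => hfin i,
            WithTop.coe_le_coe] at hsum
          simp only [ite_mul, zero_mul, Finset.sum_ite_mem, Finset.univ_inter]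
          refine le_trans (le_of_eq ?_) (hle.trans
            (mul_le_mul_of_nonneg_left hsum (by positivity)))
          exact Finset.sum_congr rfl fun f hf => by rw [(hS f hf).1]
        · have hfS : f ∈ S := by
            by_contra hfS
            exact hf (if_neg hfS)
          rw [(hS f hfS).1]
          exact (hS f hfS).2
    · have hfS : f ∈ S := by
        by_contra hfS
        simp [hfS] at hf
      exact (Finset.mem_filter.mp hfS).2.1

theorem stmt_2 {σ : Type} [Fintype σ] (ar : σ → ℕ) (har : ∀ R, 0 < ar R)
    {A B : Type} [Fintype A] [DecidableEq A] [Fintype B]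
    (vA : ∀ R : σ, (Fin (ar R) → A) → WithTop ℚ)
    (vB : ∀ R : σ, (Fin (ar R) → B) → WithTop ℚ)
    (htemp : ∃ μ : (A → B) → ℚ, IsFracHom ar vA vB μ) :
    (∀ (I : Type) [Fintype I] [DecidableEq I]
        (vI : ∀ R : σ, (Fin (ar R) → I) → ℚ), NNeg ar vI →
        toE (Opt ar vI vB) ≤ OptBLP ar vI vA) ↔
      ∀ n : ℕ, 1 ≤ n → ∃ ω : ((Fin n → A) → B) → ℚ,
        IsFracPoly ar vA vB n ω ∧ ∀ f, 0 < ω f → IsSymmetricOp f := by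
  constructor
  · intro h n hn
    refine exists_symmetric_fracPoly_of_Opt_le_objVal hn fun vI hI pv pc hfeas => ?_
    rw [← toE_le_toE]
    exact (h (Fin n → A) vI hI).trans (sInf_le ⟨pv, pc, hfeas, rfl⟩)
  · intro h I _ _ vI hI
    refine le_sInf ?_
    rintro _ ⟨pv, pc, hfeas, rfl⟩
    exact toE_le_toE.mpr (Opt_le_objVal_of_symmetric_fracPoly har h hI hfeas)

end PVCSP
end

section
/- Let σ be a finite signature and A, B valued σ-structures such that Opt(J',B) ≤ Opt(I',A) for all connected non-negative finite-valued σ-structures I', J' with I' ≡₁ J'. Then for all connected non-negative finite-valued σ-structures I and J that are weakly congruent (i.e., |J|·δ(I) = |I|·δ(J) as multisets with scaled multiplicities): |I|·Opt(J,B) ≤ |J|·Opt(I,A). -/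
open scoped BigOperators Classical

namespace PVCSP

/-! ## Iterated degrees as sums over incident pairs -/

/-- The multiset `{(l, x)}`, or the empty multiset when the label `l` is empty. -/
def labelSingle {α : Type} (l : Finset ℕ) (x : α) : Multiset (Finset ℕ × α) :=
  if l.Nonempty then {(l, x)} else 0

theorem labelSingle_empty {α : Type} (x : α) : labelSingle ∅ x = 0 := by
  simp [labelSingle]

theorem edgeLab_nonempty {σ : Type} {ar : σ → ℕ} {I : Type} [DecidableEq I]
    (u : I) (c : CVert σ ar I) : (edgeLab u c).Nonempty ↔ ∃ i, c.2 i = u := by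
  simp [edgeLab, Finset.filter_nonempty_iff]

theorem multiset_map_filter_eq_sum {α β : Type} [Fintype α] (p : α → Prop) [DecidablePred p]
    (f : α → β) :
    ((Finset.univ.filter p).val).map f = ∑ a, if p a then ({f a} : Multiset β) else 0 := by
  rw [← Finset.sum_filter, ← Multiset.sum_map_singleton (Multiset.map f _), Multiset.map_map]
  rfl

theorem degV_succ_var {σ : Type} [Fintype σ] (ar : σ → ℕ) {I : Type} [Fintype I]
    [DecidableEq I] (vI : ∀ R : σ, (Fin (ar R) → I) → ℚ) (k : ℕ) (u : I) :
    @Eq (Multiset (Finset ℕ × Deg σ k)) (degV ar vI (k + 1) (Sum.inl u))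
      (∑ c : CVert σ ar I, if 0 < vI c.1 c.2 then
        labelSingle (edgeLab u c) (degV ar vI k (Sum.inr c)) else 0) := by
  rw [degV, multiset_map_filter_eq_sum]
  refine Finset.sum_congr rfl fun c _ => ?_
  simp only [labelSingle, edgeLab_nonempty, ite_and]

theorem degV_succ_con {σ : Type} [Fintype σ] (ar : σ → ℕ) {I : Type} [Fintype I]
    [DecidableEq I] (vI : ∀ R : σ, (Fin (ar R) → I) → ℚ) (k : ℕ) (c : CVert σ ar I) :
    @Eq (Multiset (Finset ℕ × Deg σ k)) (degV ar vI (k + 1) (Sum.inr c))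
      (∑ u : I, labelSingle (edgeLab u c) (degV ar vI k (Sum.inl u))) := by
  rw [degV, multiset_map_filter_eq_sum]
  refine Finset.sum_congr rfl fun u _ => ?_
  simp only [labelSingle, edgeLab_nonempty]

theorem sum_bind {ι α β : Type} (s : Finset ι) (X : ι → Multiset α) (f : α → Multiset β) :
    (∑ i ∈ s, X i).bind f = ∑ i ∈ s, (X i).bind f :=
  map_sum (⟨⟨fun D => D.bind f, Multiset.zero_bind f⟩, fun a b => Multiset.add_bind a b f⟩ :
    Multiset α →+ Multiset β) X s

theorem labelSingle_bind {α β : Type} (l : Finset ℕ) (x : α)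
    (f : Finset ℕ × α → Multiset β) :
    (labelSingle l x).bind f = if l.Nonempty then f (l, x) else 0 := by
  unfold labelSingle
  split_ifs <;> simp

/-! ## Twisted blow-ups -/

section Blowup

variable {σ : Type} {ar : σ → ℕ} {I Z : Type}

/-- The tuple constantly equal to `n`, with its first entry replaced by `τ n` if `s` is true. -/
def copyTuple (τ : Equiv.Perm Z) (s : Bool) (n : Z) {r : ℕ} : Fin r → Z :=
  fun j => if s = true ∧ j.val = 0 then τ n else n

/-- The weight of a tuple of copy indices: `1` on constant tuples, `ε` on tuples that are
constant up to a twist by `τ` in their first entry. -/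
noncomputable def copyWeight (τ : Equiv.Perm Z) (ε : ℚ) {r : ℕ} (κ : Fin r → Z) : ℚ :=
  if ∃ n, κ = copyTuple τ false n then 1 else if ∃ n, κ = copyTuple τ true n then ε else 0

/-- `Z`-many copies of `vI`, linked by twisted constraints scaled by `ε`. -/
noncomputable def blowup (τ : Equiv.Perm Z) (ε : ℚ) (vI : ∀ R : σ, (Fin (ar R) → I) → ℚ) :
    ∀ R : σ, (Fin (ar R) → I × Z) → ℚ :=
  fun R t => vI R (fun j => (t j).1) * copyWeight τ ε (fun j => (t j).2)

/-- The `n`-th copy (plain or twisted) of a constraint. -/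
def copyCon (τ : Equiv.Perm Z) (s : Bool) (n : Z) (c : CVert σ ar I) : CVert σ ar (I × Z) :=
  ⟨c.1, fun j => (c.2 j, copyTuple τ s n j)⟩

theorem copyTuple_false_ne_true {τ : Equiv.Perm Z} (hτ : ∀ z, τ z ≠ z) {r : ℕ} (hr : 2 ≤ r)
    (m n : Z) : (copyTuple τ false m : Fin r → Z) ≠ copyTuple τ true n := by
  intro h
  have h0 := congrFun h ⟨0, by omega⟩
  have h1 := congrFun h ⟨1, by omega⟩
  simp [copyTuple] at h0 h1
  exact hτ n (h0.symm.trans h1)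

theorem copyWeight_false (τ : Equiv.Perm Z) (ε : ℚ) {r : ℕ} (n : Z) :
    copyWeight τ ε (copyTuple τ false n : Fin r → Z) = 1 :=
  if_pos ⟨n, rfl⟩

theorem copyWeight_true {τ : Equiv.Perm Z} (hτ : ∀ z, τ z ≠ z) (ε : ℚ) {r : ℕ} (hr : 2 ≤ r)
    (n : Z) : copyWeight τ ε (copyTuple τ true n : Fin r → Z) = ε := by
  rw [copyWeight, if_neg, if_pos ⟨n, rfl⟩]
  rintro ⟨m, hm⟩
  exact copyTuple_false_ne_true hτ hr m n hm.symm

theorem copyWeight_nonneg (τ : Equiv.Perm Z) {ε : ℚ} (hε : 0 < ε) {r : ℕ} (κ : Fin r → Z) :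
    0 ≤ copyWeight τ ε κ := by
  unfold copyWeight
  split_ifs <;> positivity

theorem sum_copyTuple [Fintype Z] {M : Type} [AddCommMonoid M] {τ : Equiv.Perm Z}
    (hτ : ∀ z, τ z ≠ z) (ε : ℚ) {r : ℕ} (hr : 0 < r) (g : (Fin r → Z) → M)
    (hg : ∀ κ, copyWeight τ ε κ = 0 → g κ = 0) :
    ∑ κ, g κ = (∑ n, g (copyTuple τ false n)) +
      if 2 ≤ r then ∑ n, g (copyTuple τ true n) else 0 := by
  have hf : Function.Injective (fun n : Z => (copyTuple τ false n : Fin r → Z)) := by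
    intro m n h
    simpa [copyTuple] using congrFun h ⟨0, hr⟩
  split_ifs with h2
  · have ht : Function.Injective (fun n : Z => (copyTuple τ true n : Fin r → Z)) := by
      intro m n h
      simpa [copyTuple] using congrFun h ⟨0, hr⟩
    let e : Z ⊕ Z → Fin r → Z :=
      Sum.elim (fun n => copyTuple τ false n) (fun n => copyTuple τ true n)
    refine Eq.trans (Eq.symm ?_) (Fintype.sum_sum_type (fun x => g (e x)))
    refine Fintype.sum_of_injective e ?_ _ _ ?_ fun _ => rfl
    · rintro (m | m) (n | n) h
      · exact congrArg _ (hf h)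
      · exact absurd h (copyTuple_false_ne_true hτ h2 m n)
      · exact absurd h.symm (copyTuple_false_ne_true hτ h2 n m)
      · exact congrArg _ (ht h)
    · intro κ hκ
      apply hg
      rw [copyWeight, if_neg, if_neg]
      · rintro ⟨n, rfl⟩
        exact hκ ⟨Sum.inr n, rfl⟩
      · rintro ⟨n, rfl⟩
        exact hκ ⟨Sum.inl n, rfl⟩
  · rw [add_zero]
    symm
    refine Fintype.sum_of_injective _ hf _ _ ?_ fun _ => rfl
    intro κ hκ
    obtain rfl : r = 1 := by omega
    exact absurd ⟨κ 0, by ext j; simp [copyTuple, Subsingleton.elim j 0]⟩ hκ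

theorem blowup_nneg {vI : ∀ R : σ, (Fin (ar R) → I) → ℚ} (h : NNeg ar vI)
    (τ : Equiv.Perm Z) {ε : ℚ} (hε : 0 < ε) : NNeg ar (blowup τ ε vI) :=
  fun _ _ => mul_nonneg (h _ _) (copyWeight_nonneg τ hε _)

theorem blowup_copyCon_false (τ : Equiv.Perm Z) (ε : ℚ)
    (vI : ∀ R : σ, (Fin (ar R) → I) → ℚ) (n : Z) (c : CVert σ ar I) :
    blowup τ ε vI (copyCon τ false n c).1 (copyCon τ false n c).2 = vI c.1 c.2 := by
  change vI c.1 c.2 * copyWeight τ ε (copyTuple τ false n : Fin (ar c.1) → Z) = _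
  rw [copyWeight_false, mul_one]

theorem blowup_copyCon_true {τ : Equiv.Perm Z} (hτ : ∀ z, τ z ≠ z) (ε : ℚ)
    (vI : ∀ R : σ, (Fin (ar R) → I) → ℚ) (n : Z) {c : CVert σ ar I} (hc : 2 ≤ ar c.1) :
    blowup τ ε vI (copyCon τ true n c).1 (copyCon τ true n c).2 = ε * vI c.1 c.2 := by
  change vI c.1 c.2 * copyWeight τ ε (copyTuple τ true n : Fin (ar c.1) → Z) = _
  rw [copyWeight_true hτ ε hc, mul_comm]

theorem sum_copyCon [Fintype σ] [Fintype I] [Fintype Z] {M : Type} [AddCommMonoid M] 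
    (har : ∀ R, 0 < ar R)
    {τ : Equiv.Perm Z} (hτ : ∀ z, τ z ≠ z) (ε : ℚ) (G : CVert σ ar (I × Z) → M)
    (hG : ∀ c, copyWeight τ ε (fun j => (c.2 j).2) = 0 → G c = 0) :
    ∑ c, G c = ∑ c : CVert σ ar I, ((∑ n, G (copyCon τ false n c)) +
      if 2 ≤ ar c.1 then ∑ n, G (copyCon τ true n c) else 0) := by
  rw [Fintype.sum_sigma, Fintype.sum_sigma]
  refine Finset.sum_congr rfl fun R _ => ?_
  rw [← (Equiv.arrowProdEquivProdArrow (Fin (ar R)) (fun _ => I) (fun _ => Z)).symm.sum_comp,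
    Fintype.sum_prod_type]
  refine Finset.sum_congr rfl fun v _ => ?_
  exact sum_copyTuple hτ ε (har R)
    (fun κ => G ⟨R, fun j => (v j, κ j)⟩) (fun κ h => hG _ h)

/-! ### Iterated degrees of a blow-up -/

section Degrees

variable [DecidableEq I] [DecidableEq Z]

theorem edgeLab_copyCon_false (τ : Equiv.Perm Z) (u : I) (m n : Z) (c : CVert σ ar I) :
    edgeLab (u, m) (copyCon τ false n c) = if n = m then edgeLab u c else ∅ := by
  unfold edgeLab copyCon copyTuple
  split_ifs with h
  · subst h; ext; simp
  · ext; simp [h]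

theorem edgeLab_copyCon_true {τ : Equiv.Perm Z} (hτ : ∀ z, τ z ≠ z) (u : I) (m n : Z)
    (c : CVert σ ar I) :
    edgeLab (u, m) (copyCon τ true n c) =
      if τ n = m then (edgeLab u c).filter (· = 0)
      else if n = m then (edgeLab u c).filter (· ≠ 0) else ∅ := by
  unfold edgeLab copyCon copyTuple
  split_ifs with h h'
  · subst h
    ext x
    simp only [Finset.mem_image, Finset.mem_filter, Finset.mem_univ, true_and, Prod.mk.injEq]
    constructor
    · rintro ⟨a, ⟨h1, h2⟩, rfl⟩
      refine ⟨⟨a, h1, rfl⟩, ?_⟩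
      by_contra h0
      rw [if_neg h0] at h2
      exact hτ n h2.symm
    · rintro ⟨⟨a, h1, rfl⟩, h0⟩
      exact ⟨a, ⟨h1, if_pos h0⟩, rfl⟩
  · subst h'
    ext x
    simp only [Finset.mem_image, Finset.mem_filter, Finset.mem_univ, true_and, Prod.mk.injEq]
    constructor
    · rintro ⟨a, ⟨h1, h2⟩, rfl⟩
      refine ⟨⟨a, h1, rfl⟩, ?_⟩
      intro h0
      rw [if_pos h0] at h2
      exact h h2
    · rintro ⟨⟨a, h1, rfl⟩, h0⟩
      exact ⟨a, ⟨h1, if_neg h0⟩, rfl⟩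
  · ext x
    simp only [Finset.mem_image, Finset.mem_filter, Finset.mem_univ, true_and, Prod.mk.injEq]
    simp only [Finset.notMem_empty, iff_false]
    rintro ⟨a, ⟨h1, h2⟩, rfl⟩
    split_ifs at h2
    exacts [h h2, h' h2]

/-- The two labels into which a twist splits a label. -/
def splitLabel {α : Type} (l : Finset ℕ) (x : α) : Multiset (Finset ℕ × α) :=
  labelSingle (l.filter (· = 0)) x + labelSingle (l.filter (· ≠ 0)) x

theorem splitLabel_empty {α : Type} (x : α) : splitLabel ∅ x = 0 := by
  simp [splitLabel, labelSingle]

theorem labelSingle_copyCon_true {α : Type} {τ : Equiv.Perm Z} (hτ : ∀ z, τ z ≠ z) (u : I)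
    (m n : Z) (c : CVert σ ar I) (x : α) :
    labelSingle (edgeLab (u, m) (copyCon τ true n c)) x =
      (if τ n = m then labelSingle ((edgeLab u c).filter (· = 0)) x else 0) +
      (if n = m then labelSingle ((edgeLab u c).filter (· ≠ 0)) x else 0) := by
  rw [edgeLab_copyCon_true hτ]
  split_ifs with h h' h'
  · exact absurd (h.trans h'.symm) (hτ n)
  · simp
  · simp
  · simp [labelSingle_empty]

variable [Fintype Z]

theorem sum_labelSingle_false_copies {α : Type} (τ : Equiv.Perm Z) (u : I) (m : Z)
    (c : CVert σ ar I) (x : α) :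
    ∑ n, labelSingle (edgeLab (u, m) (copyCon τ false n c)) x = labelSingle (edgeLab u c) x := by
  rw [Finset.sum_eq_single m]
  · simp [edgeLab_copyCon_false]
  · intro n _ h
    simp [edgeLab_copyCon_false, h, labelSingle_empty]
  · simp

theorem sum_labelSingle_false_vars {α : Type} (τ : Equiv.Perm Z) (u : I) (n : Z)
    (c : CVert σ ar I) (x : α) :
    ∑ m, labelSingle (edgeLab (u, m) (copyCon τ false n c)) x = labelSingle (edgeLab u c) x := by
  rw [Finset.sum_eq_single n]
  · simp [edgeLab_copyCon_false]
  · intro m _ h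
    simp [edgeLab_copyCon_false, h.symm, labelSingle_empty]
  · simp

theorem sum_labelSingle_true_copies {α : Type} {τ : Equiv.Perm Z} (hτ : ∀ z, τ z ≠ z) (u : I)
    (m : Z) (c : CVert σ ar I) (x : α) :
    ∑ n, labelSingle (edgeLab (u, m) (copyCon τ true n c)) x = splitLabel (edgeLab u c) x := by
  simp_rw [labelSingle_copyCon_true hτ, Finset.sum_add_distrib, ← Equiv.eq_symm_apply]
  simp [splitLabel]

theorem sum_labelSingle_true_vars {α : Type} {τ : Equiv.Perm Z} (hτ : ∀ z, τ z ≠ z) (u : I)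
    (n : Z) (c : CVert σ ar I) (x : α) :
    ∑ m, labelSingle (edgeLab (u, m) (copyCon τ true n c)) x = splitLabel (edgeLab u c) x := by
  simp_rw [labelSingle_copyCon_true hτ, Finset.sum_add_distrib]
  simp [splitLabel]

/-- Whether a degree is the degree of a constraint of arity at least two. -/
def IsWide (ar : σ → ℕ) : (k : ℕ) → Deg σ k → Prop
  | 0, d => ∃ p : σ × ℚ, (d : Option (σ × ℚ)) = some p ∧ 2 ≤ ar p.1
  | k + 1, D => ∃ p, @Membership.mem _ (Multiset (Finset ℕ × Deg σ k)) _ D p ∧ 1 ∈ p.1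

theorem isWide_degV [Fintype σ] [Fintype I] (vI : ∀ R : σ, (Fin (ar R) → I) → ℚ) (k : ℕ)
    (c : CVert σ ar I) :
    IsWide ar k (degV ar vI k (Sum.inr c)) ↔ 2 ≤ ar c.1 := by
  cases k with
  | zero =>
    constructor
    · rintro ⟨p, hp, h⟩
      cases hp
      exact h
    · exact fun h => ⟨_, rfl, h⟩
  | succ k =>
    simp only [IsWide, degV, Multiset.mem_map]
    constructor
    · rintro ⟨_, ⟨u, -, rfl⟩, h⟩
      simp only [edgeLab, Finset.mem_image] at h
      obtain ⟨i, -, hi⟩ := h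
      omega
    · intro h
      refine ⟨_, ⟨c.2 ⟨1, h⟩, ?_, rfl⟩, ?_⟩
      · simp
      · simp only [edgeLab, Finset.mem_image]
        exact ⟨⟨1, h⟩, by simp, rfl⟩

/-- The degrees of the copies of a vertex in a blow-up, computed from the degree of the vertex.
The second argument is `none` for variables, `some false` for plain copies of constraints and
`some true` for twisted copies. -/
noncomputable def blowupDeg (ar : σ → ℕ) (ε : ℚ) : (k : ℕ) → Option Bool → Deg σ k → Deg σ k
  | 0, some true, d => Option.map (fun p : σ × ℚ => (p.1, ε * p.2)) d
  | 0, none, d => d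
  | 0, some false, d => d
  | k + 1, none, D => Multiset.bind D fun p =>
      labelSingle p.1 (blowupDeg ar ε k (some false) p.2) +
        if IsWide ar k p.2 then splitLabel p.1 (blowupDeg ar ε k (some true) p.2) else 0
  | k + 1, some false, D => Multiset.bind D fun p =>
      labelSingle p.1 (blowupDeg ar ε k none p.2)
  | k + 1, some true, D => Multiset.bind D fun p =>
      splitLabel p.1 (blowupDeg ar ε k none p.2)

theorem blowupDeg_succ_none (ε : ℚ) (k : ℕ) (D : Multiset (Finset ℕ × Deg σ k)) :
    @Eq (Multiset (Finset ℕ × Deg σ k)) (blowupDeg ar ε (k + 1) none D) (D.bind fun p =>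
      labelSingle p.1 (blowupDeg ar ε k (some false) p.2) +
        if IsWide ar k p.2 then splitLabel p.1 (blowupDeg ar ε k (some true) p.2) else 0) :=
  rfl

theorem blowupDeg_succ_false (ε : ℚ) (k : ℕ) (D : Multiset (Finset ℕ × Deg σ k)) :
    @Eq (Multiset (Finset ℕ × Deg σ k)) (blowupDeg ar ε (k + 1) (some false) D) (D.bind fun p =>
      labelSingle p.1 (blowupDeg ar ε k none p.2)) :=
  rfl

theorem blowupDeg_succ_true (ε : ℚ) (k : ℕ) (D : Multiset (Finset ℕ × Deg σ k)) :
    @Eq (Multiset (Finset ℕ × Deg σ k)) (blowupDeg ar ε (k + 1) (some true) D) (D.bind fun p =>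
      splitLabel p.1 (blowupDeg ar ε k none p.2)) :=
  rfl

variable [Fintype σ] [Fintype I]

theorem degV_blowup (har : ∀ R, 0 < ar R) {τ : Equiv.Perm Z} (hτ : ∀ z, τ z ≠ z) {ε : ℚ}
    (hε : 0 < ε) (vI : ∀ R : σ, (Fin (ar R) → I) → ℚ) (k : ℕ) :
    (∀ u n, degV ar (blowup τ ε vI) k (Sum.inl (u, n)) =
      blowupDeg ar ε k none (degV ar vI k (Sum.inl u))) ∧
    (∀ c n, degV ar (blowup τ ε vI) k (Sum.inr (copyCon τ false n c)) =
      blowupDeg ar ε k (some false) (degV ar vI k (Sum.inr c))) ∧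
    (∀ (c : CVert σ ar I) n, 2 ≤ ar c.1 →
      degV ar (blowup τ ε vI) k (Sum.inr (copyCon τ true n c)) =
      blowupDeg ar ε k (some true) (degV ar vI k (Sum.inr c))) := by
  induction k with
  | zero =>
    refine ⟨fun u n => rfl, fun c n => ?_, fun c n hc => ?_⟩
    · simp only [degV, blowupDeg, blowup_copyCon_false]
      rfl
    · simp only [degV, blowupDeg, blowup_copyCon_true hτ ε vI n hc]
      rfl
  | succ k ih =>
    obtain ⟨ih1, ih2, ih3⟩ := ih
    refine ⟨fun u m => ?_, fun c n => ?_, fun c n hc => ?_⟩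
    · change @Eq (Multiset (Finset ℕ × Deg σ k)) _ _
      rw [degV_succ_var, degV_succ_var, blowupDeg_succ_none, sum_bind, sum_copyCon har hτ ε]
      · refine Finset.sum_congr rfl fun c _ => ?_
        simp only [blowup_copyCon_false, ih2]
        have h2 : (if 2 ≤ ar c.1 then ∑ n, (if 0 < blowup τ ε vI (copyCon τ true n c).1
              (copyCon τ true n c).2 then labelSingle (edgeLab (u, m) (copyCon τ true n c))
              (degV ar (blowup τ ε vI) k (Sum.inr (copyCon τ true n c))) else 0) else 0) =
            if 2 ≤ ar c.1 then (if 0 < vI c.1 c.2 then splitLabel (edgeLab u c)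
              (blowupDeg ar ε k (some true) (degV ar vI k (Sum.inr c))) else 0) else 0 := by
          split_ifs with hc h
          · rw [← sum_labelSingle_true_copies hτ u m c]
            refine Finset.sum_congr rfl fun n _ => ?_
            rw [blowup_copyCon_true hτ ε vI n hc, if_pos (mul_pos hε h), ih3 c n hc]
          · refine Finset.sum_eq_zero fun n _ => ?_
            rw [blowup_copyCon_true hτ ε vI n hc, if_neg]
            rwa [mul_pos_iff_of_pos_left hε]
          · rfl
        rw [h2]
        by_cases h : 0 < vI c.1 c.2
        · simp only [h, if_true, sum_labelSingle_false_copies]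
          by_cases hl : (edgeLab u c).Nonempty
          · simp only [labelSingle_bind, hl, if_true, isWide_degV]
          · simp [Finset.not_nonempty_iff_eq_empty.1 hl, labelSingle_empty, splitLabel_empty]
        · simp [h]
      · intro c hc
        rw [if_neg]
        simp [blowup, hc]
    · change @Eq (Multiset (Finset ℕ × Deg σ k)) _ _
      rw [degV_succ_con, degV_succ_con, blowupDeg_succ_false, sum_bind, Fintype.sum_prod_type]
      refine Finset.sum_congr rfl fun u _ => ?_
      simp only [ih1, sum_labelSingle_false_vars, labelSingle_bind]
      split_ifs with hl
      · rfl
      · simp [labelSingle, hl]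
    · change @Eq (Multiset (Finset ℕ × Deg σ k)) _ _
      rw [degV_succ_con, degV_succ_con, blowupDeg_succ_true, sum_bind, Fintype.sum_prod_type]
      refine Finset.sum_congr rfl fun u _ => ?_
      simp only [ih1, sum_labelSingle_true_vars hτ, labelSingle_bind]
      split_ifs with hl
      · rfl
      · rw [Finset.not_nonempty_iff_eq_empty] at hl
        simp [hl, splitLabel_empty]

/-- The effect of a blow-up on a single iterated degree. -/
noncomputable def blowupItdeg (ar : σ → ℕ) (ε : ℚ) (d : IterDeg σ) : Multiset (IterDeg σ) :=
  if (d 0 : Option (σ × ℚ)) = none then {fun k => blowupDeg ar ε k none (d k)}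
  else {fun k => blowupDeg ar ε k (some false) (d k)} +
    if IsWide ar 0 (d 0) then {fun k => blowupDeg ar ε k (some true) (d k)} else 0

theorem degSeq_eq_sum (vI : ∀ R : σ, (Fin (ar R) → I) → ℚ) :
    degSeq ar vI = (∑ u : I, {itdeg ar vI (Sum.inl u)}) +
      ∑ c : CVert σ ar I, if 0 < vI c.1 c.2 then {itdeg ar vI (Sum.inr c)} else 0 := by
  rw [degSeq, multiset_map_filter_eq_sum]
  congr 1
  have := multiset_map_filter_eq_sum (fun _ : I => True) fun u => itdeg ar vI (Sum.inl u)
  simpa using this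

theorem degSeq_blowup (har : ∀ R, 0 < ar R) {τ : Equiv.Perm Z} (hτ : ∀ z, τ z ≠ z) {ε : ℚ}
    (hε : 0 < ε) (vI : ∀ R : σ, (Fin (ar R) → I) → ℚ) :
    degSeq ar (blowup τ ε vI) =
      Fintype.card Z • (degSeq ar vI).bind (blowupItdeg ar ε) := by
  rw [degSeq_eq_sum, degSeq_eq_sum, Multiset.add_bind, sum_bind, sum_bind, smul_add,
    Fintype.sum_prod_type, sum_copyCon har hτ ε, Finset.smul_sum, Finset.smul_sum]
  · congr 1
    · refine Finset.sum_congr rfl fun u _ => ?_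
      have h : ∀ n, itdeg ar (blowup τ ε vI) (Sum.inl (u, n)) =
          fun k => blowupDeg ar ε k none (degV ar vI k (Sum.inl u)) :=
        fun n => funext fun k => (degV_blowup har hτ hε vI k).1 u n
      have h0 : (itdeg ar vI (Sum.inl u) 0 : Option (σ × ℚ)) = none := rfl
      simp only [h, Finset.sum_const, Finset.card_univ, Multiset.singleton_bind, blowupItdeg,
        if_pos h0]
      rfl
    · refine Finset.sum_congr rfl fun c _ => ?_
      have h1 : ∀ n, itdeg ar (blowup τ ε vI) (Sum.inr (copyCon τ false n c)) =
          fun k => blowupDeg ar ε k (some false) (degV ar vI k (Sum.inr c)) :=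
        fun n => funext fun k => (degV_blowup har hτ hε vI k).2.1 c n
      have h2 : 2 ≤ ar c.1 → ∀ n, itdeg ar (blowup τ ε vI) (Sum.inr (copyCon τ true n c)) =
          fun k => blowupDeg ar ε k (some true) (degV ar vI k (Sum.inr c)) :=
        fun hc n => funext fun k => (degV_blowup har hτ hε vI k).2.2 c n hc
      have h0 : ¬ (itdeg ar vI (Sum.inr c) 0 : Option (σ × ℚ)) = none := by
        simp [itdeg, degV]
      have hw : IsWide ar 0 (itdeg ar vI (Sum.inr c) 0) ↔ 2 ≤ ar c.1 := isWide_degV vI 0 c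
      simp only [blowup_copyCon_false, h1]
      by_cases h : 0 < vI c.1 c.2
      · by_cases hc : 2 ≤ ar c.1
        · simp only [h, hc, if_true, blowup_copyCon_true hτ ε vI _ hc, mul_pos hε h, h2 hc,
            Finset.sum_const, Finset.card_univ, Multiset.singleton_bind, blowupItdeg, if_neg h0,
            if_pos (hw.2 hc), smul_add]
          rfl
        · simp only [h, hc, if_true, if_false, add_zero,
            Finset.sum_const, Finset.card_univ, Multiset.singleton_bind, blowupItdeg, if_neg h0,
            if_neg (mt hw.1 hc)]
          rfl
      · by_cases hc : 2 ≤ ar c.1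
        · simp [h, hc, blowup_copyCon_true hτ ε vI _ hc, mul_pos_iff_of_pos_left hε]
        · simp [h, hc]
  · intro c hc
    rw [if_neg]
    simp [blowup, hc]

end Degrees

end Blowup

/-! ## Connectedness -/

section Connectedness

variable {σ : Type} {ar : σ → ℕ} {I Z : Type}

theorem Adj.symm {vI : ∀ R : σ, (Fin (ar R) → I) → ℚ} :
    ∀ {x y}, Adj ar vI x y → Adj ar vI y x
  | Sum.inl _, Sum.inr _, h => h
  | Sum.inr _, Sum.inl _, h => h

theorem conn_of_reachable_vars (har : ∀ R, 0 < ar R) [Nonempty I]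
    {vI : ∀ R : σ, (Fin (ar R) → I) → ℚ}
    (h : ∀ u v, Relation.ReflTransGen (Adj ar vI) (Sum.inl u) (Sum.inl v)) : Conn ar vI := by
  have key : ∀ x, IsVert ar vI x → ∃ u, Relation.ReflTransGen (Adj ar vI) x (Sum.inl u) := by
    rintro (u | c) hx
    · exact ⟨u, .refl⟩
    · exact ⟨c.2 ⟨0, har _⟩, .single ⟨hx, _, rfl⟩⟩
  refine ⟨‹_›, fun x y hx hy => ?_⟩
  have : Std.Symm (Adj ar vI) := ⟨fun _ _ => Adj.symm⟩
  obtain ⟨u, hu⟩ := key x hx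
  obtain ⟨v, hv⟩ := key y hy
  exact hu.trans ((h u v).trans (Std.Symm.symm _ _ hv))

theorem blowup_conn (har : ∀ R, 0 < ar R) [Nonempty Z] {τ : Equiv.Perm Z} (hτ : ∀ z, τ z ≠ z)
    (hcyc : ∀ a b, Relation.ReflTransGen (fun x y => y = τ x) a b) {ε : ℚ} (hε : 0 < ε)
    {vI : ∀ R : σ, (Fin (ar R) → I) → ℚ} (hI : Conn ar vI) {c : CVert σ ar I}
    (hc : 0 < vI c.1 c.2) (hc2 : 2 ≤ ar c.1) : Conn ar (blowup τ ε vI) := by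
  have := hI.1
  have hcopy : ∀ n u v, Relation.ReflTransGen (Adj ar (blowup τ ε vI))
      (Sum.inl (u, n)) (Sum.inl (v, n)) := by
    intro n u v
    refine (hI.2 (Sum.inl u) (Sum.inl v) trivial trivial).lift
      (Sum.map (fun w => (w, n)) (copyCon τ false n)) ?_
    have hadj : ∀ w (d : CVert σ ar I), 0 < vI d.1 d.2 ∧ (∃ i, d.2 i = w) →
        Adj ar (blowup τ ε vI) (Sum.inl (w, n)) (Sum.inr (copyCon τ false n d)) := by
      rintro w d ⟨hd, i, rfl⟩
      refine ⟨?_, i, ?_⟩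
      · rwa [blowup_copyCon_false]
      · simp [copyCon, copyTuple]
    rintro (w | d) (w' | d') h
    · exact h.elim
    · exact hadj w d' h
    · exact (hadj w' d h).symm
    · exact h.elim
  have hstep : ∀ n u v, Relation.ReflTransGen (Adj ar (blowup τ ε vI))
      (Sum.inl (u, n)) (Sum.inl (v, τ n)) := by
    intro n u v
    have hpos : 0 < blowup τ ε vI (copyCon τ true n c).1 (copyCon τ true n c).2 := by
      rw [blowup_copyCon_true hτ ε vI n hc2]
      exact mul_pos hε hc
    have h1 : Adj ar (blowup τ ε vI) (Sum.inl (c.2 ⟨1, hc2⟩, n))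
        (Sum.inr (copyCon τ true n c)) :=
      ⟨hpos, ⟨1, hc2⟩, by simp [copyCon, copyTuple]⟩
    have h0 : Adj ar (blowup τ ε vI) (Sum.inr (copyCon τ true n c))
        (Sum.inl (c.2 ⟨0, har _⟩, τ n)) :=
      ⟨hpos, ⟨0, har _⟩, by simp [copyCon, copyTuple]⟩
    exact (hcopy n u _).trans (.head h1 (.head h0 (hcopy (τ n) _ v)))
  refine conn_of_reachable_vars har ?_
  rintro ⟨u, a⟩ ⟨v, b⟩
  induction hcyc a b generalizing v with
  | refl => exact hcopy a u v
  | tail _ h ih => exact (ih v).trans (h ▸ hstep _ v v)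

theorem subsingleton_of_arity_lt_two {vI : ∀ R : σ, (Fin (ar R) → I) → ℚ} (hI : Conn ar vI)
    (h : ∀ c : CVert σ ar I, 0 < vI c.1 c.2 → ar c.1 < 2) : Subsingleton I := by
  refine ⟨fun u v => ?_⟩
  have key : ∀ x, Relation.ReflTransGen (Adj ar vI) (Sum.inl u) x →
      Sum.elim (fun w => w = u) (fun c : CVert σ ar I => ∀ i, c.2 i = u) x := by
    intro x hx
    induction hx with
    | refl => rfl
    | @tail y z _ hyz ih =>
      rcases y with w | d <;> rcases z with w' | d'
      · exact hyz.elim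
      · obtain ⟨hpos, i, hi⟩ := hyz
        intro j
        have hd := h d' hpos
        obtain rfl : i = j := by ext; omega
        exact hi.trans ih
      · obtain ⟨-, i, hi⟩ := hyz
        exact hi.symm.trans (ih i)
      · exact hyz.elim
  exact (key _ (hI.2 (Sum.inl u) (Sum.inl v) trivial trivial)).symm

end Connectedness

theorem WeakCongr.exists_wide {σ : Type} [Fintype σ] {ar : σ → ℕ} {I J : Type}
    [Fintype I] [DecidableEq I] [Fintype J] [DecidableEq J] [Nonempty J]
    {vI : ∀ R : σ, (Fin (ar R) → I) → ℚ} {vJ : ∀ R : σ, (Fin (ar R) → J) → ℚ}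
    (h : WeakCongr ar vI vJ) {c : CVert σ ar I} (hc : 0 < vI c.1 c.2) (hc2 : 2 ≤ ar c.1) :
    ∃ d : CVert σ ar J, 0 < vJ d.1 d.2 ∧ 2 ≤ ar d.1 := by
  have hmem : itdeg ar vI (Sum.inr c) ∈ Fintype.card J • degSeq ar vI := by
    rw [Multiset.mem_nsmul]
    refine ⟨Fintype.card_ne_zero, ?_⟩
    rw [degSeq, Multiset.mem_add]
    exact Or.inr (Multiset.mem_map_of_mem _ (by simpa using hc))
  rw [h, Multiset.mem_nsmul, degSeq, Multiset.mem_add, Multiset.mem_map, Multiset.mem_map] at hmem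
  obtain ⟨-, ⟨u, -, hu⟩ | ⟨d, hd, hdc⟩⟩ := hmem
  · have h0 : (none : Option (σ × ℚ)) = some (c.1, vI c.1 c.2) := congrFun hu 0
    cases h0
  · have h0 : some (d.1, vJ d.1 d.2) = some (c.1, vI c.1 c.2) := congrFun hdc 0
    refine ⟨d, by simpa using hd, ?_⟩
    rw [Option.some.injEq, Prod.mk.injEq] at h0
    rwa [h0.1]

/-! ## Values of assignments -/

section Values

variable {σ : Type} [Fintype σ] {ar : σ → ℕ} {I A : Type} [Fintype I]

/-- The value of an assignment when infinite costs are replaced by `0`. -/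
def finVal (vI : ∀ R : σ, (Fin (ar R) → I) → ℚ)
    (vA : ∀ R : σ, (Fin (ar R) → A) → WithTop ℚ) (h : I → A) : ℚ :=
  ∑ c : CVert σ ar I, vI c.1 c.2 * (vA c.1 fun i => h (c.2 i)).untopD 0

theorem val_eq_finVal {vI : ∀ R : σ, (Fin (ar R) → I) → ℚ}
    {vA : ∀ R : σ, (Fin (ar R) → A) → WithTop ℚ} {h : I → A}
    (hfin : ∀ R v, vI R v ≠ 0 → vA R (fun i => h (v i)) ≠ ⊤) :
    Val ar vI vA h = (finVal vI vA h : ℚ) := by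
  rw [Val, finVal, ← Fintype.sum_sigma', WithTop.coe_sum]
  refine Finset.sum_congr rfl fun c _ => ?_
  by_cases h0 : vI c.1 c.2 = 0
  · simp [h0]
  · obtain ⟨q, hq⟩ := WithTop.ne_top_iff_exists.1 (hfin c.1 c.2 h0)
    rw [← hq]
    simp

theorem ne_top_of_val_ne_top {vI : ∀ R : σ, (Fin (ar R) → I) → ℚ}
    {vA : ∀ R : σ, (Fin (ar R) → A) → WithTop ℚ} {h : I → A} (hval : Val ar vI vA h ≠ ⊤)
    (R : σ) (v : Fin (ar R) → I) (h0 : vI R v ≠ 0) : vA R (fun i => h (v i)) ≠ ⊤ := by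
  intro htop
  apply hval
  rw [Val, WithTop.sum_eq_top]
  refine ⟨R, Finset.mem_univ _, ?_⟩
  rw [WithTop.sum_eq_top]
  refine ⟨v, Finset.mem_univ _, ?_⟩
  rw [htop, WithTop.mul_top]
  exact_mod_cast h0

theorem exists_val_eq_opt [DecidableEq I] [Fintype A] {vI : ∀ R : σ, (Fin (ar R) → I) → ℚ}
    {vA : ∀ R : σ, (Fin (ar R) → A) → WithTop ℚ} (hopt : Opt ar vI vA ≠ ⊤) :
    ∃ h, Val ar vI vA h = Opt ar vI vA := by
  have hne : (Finset.univ : Finset (I → A)).Nonempty := by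
    rw [Finset.nonempty_iff_ne_empty]
    intro h
    exact hopt (by rw [Opt, h, Finset.inf_empty])
  obtain ⟨h, -, hh⟩ := Finset.exists_mem_eq_inf _ hne fun h => Val ar vI vA h
  exact ⟨h, hh.symm⟩

theorem opt_le_val [DecidableEq I] [Fintype A] (vI : ∀ R : σ, (Fin (ar R) → I) → ℚ)
    (vA : ∀ R : σ, (Fin (ar R) → A) → WithTop ℚ) (h : I → A) :
    Opt ar vI vA ≤ Val ar vI vA h :=
  Finset.inf_le (Finset.mem_univ h)

variable {Z : Type} [Fintype Z]

/-- The contribution of the twisted constraints to the value of an assignment of a blow-up. -/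
noncomputable def twistVal (τ : Equiv.Perm Z) (vI : ∀ R : σ, (Fin (ar R) → I) → ℚ)
    (vA : ∀ R : σ, (Fin (ar R) → A) → WithTop ℚ) (h : I × Z → A) : ℚ :=
  ∑ c : CVert σ ar I, if 2 ≤ ar c.1 then
    ∑ n, vI c.1 c.2 * (vA c.1 fun i => h ((copyCon τ true n c).2 i)).untopD 0 else 0

theorem finVal_blowup (har : ∀ R, 0 < ar R) {τ : Equiv.Perm Z} (hτ : ∀ z, τ z ≠ z) (ε : ℚ)
    (vI : ∀ R : σ, (Fin (ar R) → I) → ℚ)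
    (vA : ∀ R : σ, (Fin (ar R) → A) → WithTop ℚ) (h : I × Z → A) :
    finVal (blowup τ ε vI) vA h =
      (∑ n, finVal vI vA fun u => h (u, n)) + ε * twistVal τ vI vA h := by
  rw [finVal, sum_copyCon har hτ ε, Finset.sum_add_distrib]
  · congr 1
    · rw [Finset.sum_comm]
      refine Finset.sum_congr rfl fun n _ => Finset.sum_congr rfl fun c _ => ?_
      rw [blowup_copyCon_false]
      rfl
    · rw [twistVal, Finset.mul_sum]
      refine Finset.sum_congr rfl fun c _ => ?_
      split_ifs with hc
      · rw [Finset.mul_sum]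
        refine Finset.sum_congr rfl fun n _ => ?_
        rw [blowup_copyCon_true hτ ε vI n hc, mul_assoc]
        rfl
      · simp
  · intro c hc
    simp [blowup, hc]

theorem opt_blowup_le [DecidableEq I] [DecidableEq Z] [Fintype A] (har : ∀ R, 0 < ar R)
    {τ : Equiv.Perm Z} (hτ : ∀ z, τ z ≠ z) (ε : ℚ) {vI : ∀ R : σ, (Fin (ar R) → I) → ℚ}
    {vA : ∀ R : σ, (Fin (ar R) → A) → WithTop ℚ} {h : I → A} (hval : Val ar vI vA h ≠ ⊤) :
    Opt ar (blowup τ ε vI) vA ≤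
      ((Fintype.card Z * finVal vI vA h + ε * twistVal τ vI vA (fun x => h x.1) : ℚ)) := by
  refine (opt_le_val _ _ fun x : I × Z => h x.1).trans_eq ?_
  rw [val_eq_finVal, finVal_blowup har hτ]
  · simp
  · intro R t ht
    exact ne_top_of_val_ne_top hval R (fun i => (t i).1) (left_ne_zero_of_mul ht)

/-- A bound for the contribution of the twisted constraints, independent of the assignment. -/
noncomputable def twistBound [Fintype A] (Z : Type) [Fintype Z]
    (vI : ∀ R : σ, (Fin (ar R) → I) → ℚ)
    (vA : ∀ R : σ, (Fin (ar R) → A) → WithTop ℚ) : ℚ :=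
  ∑ c : CVert σ ar I, Fintype.card Z * (vI c.1 c.2 * ∑ a, |(vA c.1 a).untopD 0|)

theorem neg_twistBound_le [Fintype A] (τ : Equiv.Perm Z) {vI : ∀ R : σ, (Fin (ar R) → I) → ℚ}
    (hI : NNeg ar vI) (vA : ∀ R : σ, (Fin (ar R) → A) → WithTop ℚ) (h : I × Z → A) :
    -twistBound Z vI vA ≤ twistVal τ vI vA h := by
  rw [twistBound, twistVal, ← Finset.sum_neg_distrib]
  refine Finset.sum_le_sum fun c _ => ?_
  split_ifs
  · rw [← nsmul_eq_mul, ← smul_neg, ← Finset.card_univ, ← Finset.sum_const]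
    refine Finset.sum_le_sum fun n _ => ?_
    rw [← mul_neg]
    refine mul_le_mul_of_nonneg_left ?_ (hI _ _)
    refine neg_le.1 ((neg_le_abs _).trans ?_)
    exact Finset.single_le_sum (f := fun a => |(vA c.1 a).untopD 0|)
      (fun a _ => abs_nonneg _) (Finset.mem_univ _)
  · have := hI c.1 c.2
    rw [neg_nonpos]
    positivity

theorem le_of_opt_blowup_le [DecidableEq I] [DecidableEq Z] [Nonempty Z] [Fintype A]
    (har : ∀ R, 0 < ar R) {τ : Equiv.Perm Z} (hτ : ∀ z, τ z ≠ z) {ε : ℚ} (hε : 0 < ε)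
    {vI : ∀ R : σ, (Fin (ar R) → I) → ℚ} (hI : NNeg ar vI)
    {vA : ∀ R : σ, (Fin (ar R) → A) → WithTop ℚ} {x : ℚ}
    (hx : Opt ar (blowup τ ε vI) vA ≤ x) :
    ∃ β : ℚ, Opt ar vI vA = β ∧ Fintype.card Z * β - ε * twistBound Z vI vA ≤ x := by
  have hopt : Opt ar (blowup τ ε vI) vA ≠ ⊤ := ne_top_of_le_ne_top WithTop.coe_ne_top hx
  obtain ⟨h, hh⟩ := exists_val_eq_opt hopt
  have hfin := ne_top_of_val_ne_top (hh.trans_ne hopt)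
  rw [← hh, val_eq_finVal hfin, finVal_blowup har hτ, WithTop.coe_le_coe] at hx
  have hval : ∀ n, Val ar vI vA (fun u => h (u, n)) = (finVal vI vA (fun u => h (u, n)) : ℚ) := by
    intro n
    refine val_eq_finVal fun R v hv => ?_
    refine hfin _ (copyCon τ false n ⟨R, v⟩).2 ?_
    rwa [blowup_copyCon_false]
  have hle : ∀ n, Opt ar vI vA ≤ (finVal vI vA (fun u => h (u, n)) : ℚ) :=
    fun n => (opt_le_val vI vA _).trans_eq (hval n)
  obtain ⟨β, hβ⟩ := WithTop.ne_top_iff_exists.1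
    (ne_top_of_le_ne_top WithTop.coe_ne_top (hle (Classical.arbitrary Z)))
  refine ⟨β, hβ.symm, le_trans ?_ hx⟩
  have h1 : Fintype.card Z * β ≤ ∑ n, finVal vI vA fun u => h (u, n) := by
    rw [← nsmul_eq_mul, ← Finset.card_univ, ← Finset.sum_const]
    refine Finset.sum_le_sum fun n _ => ?_
    have := hle n
    rwa [← hβ, WithTop.coe_le_coe] at this
  have h2 := mul_le_mul_of_nonneg_left (neg_twistBound_le τ hI vA h) hε.le
  linarith

end Values

theorem reflTransGen_addRight_one (N : ℕ) [NeZero N] (a b : ZMod N) :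
    Relation.ReflTransGen (fun x y => y = Equiv.addRight (1 : ZMod N) x) a b := by
  have key : ∀ k : ℕ,
      Relation.ReflTransGen (fun x y => y = Equiv.addRight (1 : ZMod N) x) a (a + k) := by
    intro k
    induction k with
    | zero => simpa using Relation.ReflTransGen.refl
    | succ k ih => exact ih.tail (by simp [add_assoc])
  have := key (b - a).val
  rwa [ZMod.natCast_zmod_val, add_sub_cancel] at this

theorem nsmul_bind {α β : Type} (n : ℕ) (D : Multiset α) (f : α → Multiset β) :
    (n • D).bind f = n • D.bind f :=
  map_nsmul (⟨⟨fun D => D.bind f, Multiset.zero_bind f⟩, fun a b => Multiset.add_bind a b f⟩ :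
    Multiset α →+ Multiset β) n D

theorem le_of_forall_pos_le_add_mul {a b c : ℚ} (h : ∀ ε, 0 < ε → a ≤ b + ε * c) : a ≤ b := by
  refine le_of_forall_pos_le_add fun δ hδ => ?_
  have hc : 0 < |c| + 1 := by positivity
  refine (h (δ / (|c| + 1)) (by positivity)).trans ?_
  have h1 : δ / (|c| + 1) * c ≤ δ / (|c| + 1) * (|c| + 1) :=
    mul_le_mul_of_nonneg_left ((le_abs_self c).trans (by linarith)) (by positivity)
  rw [div_mul_cancel₀ _ hc.ne'] at h1
  linarith

theorem stmt_10 {σ : Type} [Fintype σ] (ar : σ → ℕ) (har : ∀ R, 0 < ar R)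
    {A B : Type} [Fintype A] [DecidableEq A] [Fintype B]
    (vA : ∀ R : σ, (Fin (ar R) → A) → WithTop ℚ)
    (vB : ∀ R : σ, (Fin (ar R) → B) → WithTop ℚ)
    (hconn : ∀ (I' J' : Type) [Fintype I'] [DecidableEq I'] [Fintype J'] [DecidableEq J']
        (vI' : ∀ R : σ, (Fin (ar R) → I') → ℚ)
        (vJ' : ∀ R : σ, (Fin (ar R) → J') → ℚ),
        NNeg ar vI' → NNeg ar vJ' → Conn ar vI' → Conn ar vJ' →
        degSeq ar vI' = degSeq ar vJ' → Opt ar vJ' vB ≤ Opt ar vI' vA) :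
    ∀ (I J : Type) [Fintype I] [DecidableEq I] [Fintype J] [DecidableEq J]
        (vI : ∀ R : σ, (Fin (ar R) → I) → ℚ)
        (vJ : ∀ R : σ, (Fin (ar R) → J) → ℚ),
        NNeg ar vI → NNeg ar vJ → Conn ar vI → Conn ar vJ →
        WeakCongr ar vI vJ →
        (Fintype.card I : WithTop ℚ) * Opt ar vJ vB ≤
          (Fintype.card J : WithTop ℚ) * Opt ar vI vA := by
  intro I J _ _ _ _ vI vJ hI hJ cI cJ hW
  have := cI.1
  have := cJ.1
  by_cases htop : Opt ar vI vA = ⊤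
  · rw [htop, WithTop.mul_top]
    · exact le_top
    · exact_mod_cast Fintype.card_ne_zero
  by_cases hex : ∃ c : CVert σ ar I, 0 < vI c.1 c.2 ∧ 2 ≤ ar c.1
  · obtain ⟨c, hc, hc2⟩ := hex
    obtain ⟨d, hd, hd2⟩ := hW.exists_wide hc hc2
    have hcI : 0 < Fintype.card I := Fintype.card_pos
    have hcJ : 0 < Fintype.card J := Fintype.card_pos
    have hZI : Fact (1 < 2 * Fintype.card J) := ⟨by omega⟩
    have hZJ : Fact (1 < 2 * Fintype.card I) := ⟨by omega⟩
    have : NeZero (2 * Fintype.card J) := ⟨by omega⟩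
    have : NeZero (2 * Fintype.card I) := ⟨by omega⟩
    have hfix : ∀ N : ℕ, Fact (1 < N) → ∀ z : ZMod N, Equiv.addRight (1 : ZMod N) z ≠ z := by
      intro N _ z
      simp
    obtain ⟨h, hh⟩ := exists_val_eq_opt htop
    have hval : Val ar vI vA h ≠ ⊤ := hh.trans_ne htop
    have hq : Opt ar vI vA = (finVal vI vA h : ℚ) :=
      hh.symm.trans (val_eq_finVal (ne_top_of_val_ne_top hval))
    have key : ∀ ε : ℚ, 0 < ε → ∃ β : ℚ, Opt ar vJ vB = β ∧
        ((2 * Fintype.card I : ℕ) : ℚ) * β - ε * twistBound (ZMod (2 * Fintype.card I)) vJ vB ≤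
          ((2 * Fintype.card J : ℕ) : ℚ) * finVal vI vA h + ε * twistVal
            (Equiv.addRight (1 : ZMod (2 * Fintype.card J))) vI vA (fun x => h x.1) := by
      intro ε hε
      have hdeg : degSeq ar (blowup (Equiv.addRight (1 : ZMod (2 * Fintype.card J))) ε vI) =
          degSeq ar (blowup (Equiv.addRight (1 : ZMod (2 * Fintype.card I))) ε vJ) := by
        rw [degSeq_blowup har (hfix _ hZI) hε, degSeq_blowup har (hfix _ hZJ) hε, ZMod.card,
          ZMod.card, ← nsmul_bind, ← nsmul_bind, mul_smul, mul_smul, hW]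
      have hle := (hconn _ _ _ _ (blowup_nneg hI _ hε) (blowup_nneg hJ _ hε)
        (blowup_conn har (hfix _ hZI) (reflTransGen_addRight_one _) hε cI hc hc2)
        (blowup_conn har (hfix _ hZJ) (reflTransGen_addRight_one _) hε cJ hd hd2) hdeg).trans
        (opt_blowup_le har (hfix _ hZI) ε hval)
      simpa only [ZMod.card] using le_of_opt_blowup_le har (hfix _ hZJ) hε hJ hle
    obtain ⟨β, hβ, -⟩ := key 1 one_pos
    rw [hβ, hq]
    have hmain : ((2 * Fintype.card I : ℕ) : ℚ) * β ≤
        ((2 * Fintype.card J : ℕ) : ℚ) * finVal vI vA h := by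
      refine le_of_forall_pos_le_add_mul
        (c := twistVal (Equiv.addRight (1 : ZMod (2 * Fintype.card J))) vI vA (fun x => h x.1) +
          twistBound (ZMod (2 * Fintype.card I)) vJ vB) (fun ε hε => ?_)
      obtain ⟨β', hβ', hle⟩ := key ε hε
      rw [hβ, WithTop.coe_inj] at hβ'
      subst hβ'
      linarith
    push_cast at hmain
    have hfinal : (Fintype.card I : ℚ) * β ≤ Fintype.card J * finVal vI vA h := by linarith
    exact_mod_cast hfinal
  · push Not at hex
    have hex' : ∀ d : CVert σ ar J, 0 < vJ d.1 d.2 → ar d.1 < 2 := by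
      intro d hd
      by_contra hd2
      obtain ⟨c, hc, hc2⟩ := WeakCongr.exists_wide (Eq.symm hW) hd (not_lt.1 hd2)
      exact absurd hc2 (not_le.2 (hex c hc))
    have := subsingleton_of_arity_lt_two cI hex
    have := subsingleton_of_arity_lt_two cJ hex'
    have h1 : Fintype.card I = 1 := Fintype.card_eq_one_iff_nonempty_unique.2 (nonempty_unique I)
    have h2 : Fintype.card J = 1 := Fintype.card_eq_one_iff_nonempty_unique.2 (nonempty_unique J)
    rw [WeakCongr, h1, h2, one_smul, one_smul] at hW
    rw [h1, h2]
    simpa using hconn I J vI vJ hI hJ cI cJ hW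

end PVCSP
end
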